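/- Let π: P → H be a surjective map of Hopf algebras over a field k and B := Pᴴ. Then the category of crossed (H,B)-modules is equivalent to the category of left P-module, left P-comodule, right H-comodule, right B-module spaces with all structures pairwise compatible. The equivalence sends X to P⊗X (left structures regular on P, right structures the tensor product ones) and sends Y to its left P-coinvariants ᴾY with the new right B-action y ⋄ b := S(b₁)▷y◁b₂. -/

import Mathlib

open TensorProduct CategoryTheory

noncomputable section

/- STATEMENT 8: the category of crossed (H,B)-modules is equivalent to the
category of left P-module, left P-comodule, right H-comodule, right B-module
Hopf modules. -/

section Props
variable {k : Type} [Field k] {H : Type} [Ring H] [HopfAlgebra k H]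
variable {A : Type} [Ring A] [Algebra k A]
variable {V : Type} [AddCommGroup V] [Module k V]

/-- `ρ : V → V ⊗ H` is a right `H`-comodule structure. -/
def IsRightCoaction (ρ : V →ₗ[k] V ⊗[k] H) : Prop :=
  (∀ v, (TensorProduct.rid k V)
      ((LinearMap.lTensor V (Coalgebra.counit (R := k) (A := H))) (ρ v)) = v) ∧
  (∀ v, (LinearMap.rTensor H ρ) (ρ v) =
    (TensorProduct.assoc k V H H).symm
      ((LinearMap.lTensor V (Coalgebra.comul (R := k) (A := H))) (ρ v)))

/-- `lam : V → H ⊗ V` is a left `H`-comodule structure. -/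
def IsLeftCoaction (lam : V →ₗ[k] H ⊗[k] V) : Prop :=
  (∀ v, (TensorProduct.lid k V)
      ((LinearMap.rTensor V (Coalgebra.counit (R := k) (A := H))) (lam v)) = v) ∧
  (∀ v, (LinearMap.lTensor H lam) (lam v) =
    (TensorProduct.assoc k H H V)
      ((LinearMap.rTensor V (Coalgebra.comul (R := k) (A := H))) (lam v)))

/-- `act : V ⊗ A → V` is a right `A`-module structure on the `k`-vector space `V`. -/
def IsRightAction (act : V ⊗[k] A →ₗ[k] V) : Prop :=
  (∀ v, act (v ⊗ₜ (1 : A)) = v) ∧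
  (∀ (v : V) (a b : A), act (v ⊗ₜ (a * b)) = act (act (v ⊗ₜ a) ⊗ₜ b))

/-- `act : A ⊗ V → V` is a left `A`-module structure on the `k`-vector space `V`. -/
def IsLeftAction (act : A ⊗[k] V →ₗ[k] V) : Prop :=
  (∀ v, act ((1 : A) ⊗ₜ v) = v) ∧
  (∀ (a b : A) (v : V), act ((a * b) ⊗ₜ v) = act (a ⊗ₜ act (b ⊗ₜ v)))

end Props

variable {k : Type} [Field k]
variable {P : Type} [Ring P] [HopfAlgebra k P]
variable {H : Type} [Ring H] [HopfAlgebra k H]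

/-- The quantum homogeneous space `B = Pᴴ = {p : p₁ ⊗ π(p₂) = p ⊗ 1}`,
as a `k`-subspace of `P`. -/
def qhs (π : P →ₐc[k] H) : Submodule k P :=
  LinearMap.ker ((LinearMap.lTensor P (π : P →ₗ[k] H)) ∘ₗ
    (Coalgebra.comul (R := k) (A := P)) - (TensorProduct.mk k P H).flip 1)

lemma mem_qhs (π : P →ₐc[k] H) (p : P) :
    p ∈ qhs π ↔ (LinearMap.lTensor P (π : P →ₗ[k] H))
      (Coalgebra.comul (R := k) (A := P) p) = p ⊗ₜ (1 : H) := by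
  simp [qhs, sub_eq_zero, LinearMap.mem_ker]

lemma lTensor_pi_eq (π : P →ₐc[k] H) :
    (LinearMap.lTensor P (π : P →ₗ[k] H)) =
      (Algebra.TensorProduct.map (AlgHom.id k P) (π : P →ₐ[k] H)).toLinearMap :=
  TensorProduct.ext' fun p q => by
    simp [Algebra.TensorProduct.map_tmul]

/-- The quantum homogeneous space `B = Pᴴ` as a subalgebra of `P`. -/
def qhsAlg (π : P →ₐc[k] H) : Subalgebra k P where
  carrier := qhs π
  add_mem' ha hb := (qhs π).add_mem ha hb
  zero_mem' := (qhs π).zero_mem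
  one_mem' := by
    rw [SetLike.mem_coe, mem_qhs, Bialgebra.comul_one, Algebra.TensorProduct.one_def]
    simp
  mul_mem' := by
    intro a b ha hb
    rw [SetLike.mem_coe, mem_qhs] at ha hb ⊢
    rw [lTensor_pi_eq] at ha hb ⊢
    simp only [AlgHom.toLinearMap_apply] at ha hb ⊢
    have hc := map_mul (Bialgebra.comulAlgHom k P) a b
    simp only [Bialgebra.comulAlgHom_apply] at hc
    rw [hc, map_mul, ha, hb, Algebra.TensorProduct.tmul_mul_tmul, one_mul]
  algebraMap_mem' := by
    intro r
    rw [Algebra.algebraMap_eq_smul_one]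
    exact (qhs π).smul_mem r (by
      rw [mem_qhs, Bialgebra.comul_one, Algebra.TensorProduct.one_def]
      simp)

/-- The inclusion `B → P` as a `k`-linear map. -/
def qhsIncl (π : P →ₐc[k] H) : (qhsAlg π) →ₗ[k] P := (qhsAlg π).val.toLinearMap

/-- `coactB : B → P ⊗ B` is the restriction of the comultiplication of `P`
(such a map exists and is unique since `Δ(B) ⊆ P ⊗ B`). -/
def IsRestrictedComul (π : P →ₐc[k] H)
    (coactB : (qhsAlg π) →ₗ[k] P ⊗[k] (qhsAlg π)) : Prop :=
  (LinearMap.lTensor P (qhsIncl π)) ∘ₗ coactB =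
    (Coalgebra.comul (R := k) (A := P)) ∘ₗ (qhsIncl π)

/-- The right `H`-coaction `p ↦ p₁ ⊗ π(p₂)` on `P`. -/
def piCoact (π : P →ₐc[k] H) : P →ₗ[k] P ⊗[k] H :=
  (LinearMap.lTensor P (π : P →ₗ[k] H)) ∘ₗ (Coalgebra.comul (R := k) (A := P))

/-- The map `a ↦ a₂ ⊗ π(S(a₁))` on `P`. -/
def adCoact₀ (π : P →ₐc[k] H) : P →ₗ[k] P ⊗[k] H :=
  (LinearMap.lTensor P ((π : P →ₗ[k] H) ∘ₗ (HopfAlgebra.antipode (R := k) (A := P)))) ∘ₗ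
    (TensorProduct.comm k P P).toLinearMap ∘ₗ
    (Coalgebra.comul (R := k) (A := P))

/-- The crossed `(H,B)`-module condition
`x₍₀₎ ◁ b ⊗ x₍₁₎ = (x ◁ b₂)₍₀₎ ⊗ π(b₁)(x ◁ b₂)₍₁₎` for a right `B`-module and
right `H`-comodule `X`, where `Δ(b) = b₁ ⊗ b₂ ∈ P ⊗ B` is given by `coactB`. -/
def IsCrossedPair (π : P →ₐc[k] H)
    (coactB : (qhsAlg π) →ₗ[k] P ⊗[k] (qhsAlg π))
    {X : Type} [AddCommGroup X] [Module k X]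
    (ract : X ⊗[k] (qhsAlg π) →ₗ[k] X) (ρ : X →ₗ[k] X ⊗[k] H) : Prop :=
  (LinearMap.rTensor H ract) ∘ₗ
      (TensorProduct.assoc k X (qhsAlg π) H).symm.toLinearMap ∘ₗ
      (LinearMap.lTensor X (TensorProduct.comm k H (qhsAlg π)).toLinearMap) ∘ₗ
      (TensorProduct.assoc k X H (qhsAlg π)).toLinearMap ∘ₗ
      (LinearMap.rTensor (qhsAlg π) ρ) =
  (LinearMap.lTensor X (LinearMap.mul' k H)) ∘ₗ
      (TensorProduct.leftComm k H X H).toLinearMap ∘ₗ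
      (TensorProduct.map (π : P →ₗ[k] H) (ρ ∘ₗ ract)) ∘ₗ
      (TensorProduct.leftComm k X P (qhsAlg π)).toLinearMap ∘ₗ
      (LinearMap.lTensor X coactB)

/-- A left `P`-module, left `P`-comodule, right `H`-comodule, right `B`-module
with all structures pairwise compatible, on a fixed `k`-vector space `Y`.
Here `coactB` is the restricted comultiplication `B → P ⊗ B`. -/
structure PPHBStr (π : P →ₐc[k] H)
    (coactB : (qhsAlg π) →ₗ[k] P ⊗[k] (qhsAlg π))
    (Y : Type) [AddCommGroup Y] [Module k Y] where
  lact : P ⊗[k] Y →ₗ[k] Y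
  ract : Y ⊗[k] (qhsAlg π) →ₗ[k] Y
  lam : Y →ₗ[k] P ⊗[k] Y
  ρ : Y →ₗ[k] Y ⊗[k] H
  lact_action : IsLeftAction lact
  ract_action : IsRightAction ract
  lam_coaction : IsLeftCoaction lam
  ρ_coaction : IsRightCoaction ρ
  acts_comm : ∀ (p : P) (y : Y) (b : qhsAlg π),
    ract (lact (p ⊗ₜ y) ⊗ₜ b) = lact (p ⊗ₜ ract (y ⊗ₜ b))
  coacts_comm : ∀ y, (LinearMap.rTensor H lam) (ρ y) =
    (TensorProduct.assoc k P Y H).symm ((LinearMap.lTensor P ρ) (lam y))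
  /-- `λ(p ▷ y) = p₁ y₍₋₁₎ ⊗ p₂ ▷ y₍₀₎` -/
  lact_lam : lam ∘ₗ lact =
    (TensorProduct.map (LinearMap.mul' k P) lact) ∘ₗ
      (tensorTensorTensorComm k P P P Y).toLinearMap ∘ₗ
      (TensorProduct.map (Coalgebra.comul (R := k) (A := P)) lam)
  /-- `ρ(p ▷ y) = p₁ ▷ y₍₀₎ ⊗ π(p₂) y₍₁₎` -/
  lact_ρ : ρ ∘ₗ lact =
    (TensorProduct.map lact (LinearMap.mul' k H)) ∘ₗ
      (tensorTensorTensorComm k P H Y H).toLinearMap ∘ₗ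
      (TensorProduct.map (piCoact π) ρ)
  /-- `λ(y ◁ b) = y₍₋₁₎ b₁ ⊗ y₍₀₎ ◁ b₂` -/
  ract_lam : lam ∘ₗ ract =
    (TensorProduct.map (LinearMap.mul' k P) ract) ∘ₗ
      (tensorTensorTensorComm k P Y P (qhsAlg π)).toLinearMap ∘ₗ
      (TensorProduct.map lam coactB)
  /-- `ρ(y ◁ b) = y₍₀₎ ◁ b ⊗ y₍₁₎` (`B` carries the trivial `H`-coaction) -/
  ract_ρ : ρ ∘ₗ ract =
    (LinearMap.rTensor H ract) ∘ₗ
      (TensorProduct.assoc k Y (qhsAlg π) H).symm.toLinearMap ∘ₗ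
      (LinearMap.lTensor Y (TensorProduct.comm k H (qhsAlg π)).toLinearMap) ∘ₗ
      (TensorProduct.assoc k Y H (qhsAlg π)).toLinearMap ∘ₗ
      (LinearMap.rTensor (qhsAlg π) ρ)

variable (π : P →ₐc[k] H) (coactB : (qhsAlg π) →ₗ[k] P ⊗[k] (qhsAlg π))

/-- The category of crossed `(H,B)`-modules. -/
structure CrossedMod where
  V : Type
  [acg : AddCommGroup V]
  [mod : Module k V]
  ract : V ⊗[k] (qhsAlg π) →ₗ[k] V
  ρ : V →ₗ[k] V ⊗[k] H
  ract_action : IsRightAction ract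
  ρ_coaction : IsRightCoaction ρ
  crossed : IsCrossedPair π coactB ract ρ

attribute [instance] CrossedMod.acg CrossedMod.mod

namespace CrossedMod
variable {π coactB}

/-- Morphisms of crossed `(H,B)`-modules. -/
def Pres (X Y : CrossedMod π coactB) (f : X.V →ₗ[k] Y.V) : Prop :=
  (∀ (v : X.V) (b : qhsAlg π), f (X.ract (v ⊗ₜ b)) = Y.ract (f v ⊗ₜ b)) ∧
  (∀ v, Y.ρ (f v) = (LinearMap.rTensor H f) (X.ρ v))

instance : Category (CrossedMod π coactB) where
  Hom X Y := {f : X.V →ₗ[k] Y.V // Pres X Y f}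
  id X := ⟨LinearMap.id, fun _ _ => rfl, fun v => by simp [LinearMap.rTensor_id]⟩
  comp {X Y Z} f g := ⟨g.1 ∘ₗ f.1, by
    obtain ⟨f, hf1, hf2⟩ := f
    obtain ⟨g, hg1, hg2⟩ := g
    refine ⟨fun v b => ?_, fun v => ?_⟩
    · simp [hf1, hg1]
    · simp only [LinearMap.comp_apply]
      rw [hg2, hf2, ← LinearMap.comp_apply, ← LinearMap.rTensor_comp]⟩
  id_comp f := Subtype.ext (LinearMap.comp_id _)
  comp_id f := Subtype.ext (LinearMap.id_comp _)
  assoc f g h := Subtype.ext rfl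

end CrossedMod

/-- The category of left `P`-module, left `P`-comodule, right `H`-comodule,
right `B`-module Hopf modules. -/
structure PPHBMod where
  V : Type
  [acg : AddCommGroup V]
  [mod : Module k V]
  str : PPHBStr π coactB V

attribute [instance] PPHBMod.acg PPHBMod.mod

namespace PPHBMod
variable {π coactB}

/-- Morphisms of `(P,P,H,B)`-Hopf modules. -/
def Pres (X Y : PPHBMod π coactB) (f : X.V →ₗ[k] Y.V) : Prop :=
  (∀ (p : P) (v : X.V), f (X.str.lact (p ⊗ₜ v)) = Y.str.lact (p ⊗ₜ f v)) ∧
  (∀ (v : X.V) (b : qhsAlg π), f (X.str.ract (v ⊗ₜ b)) = Y.str.ract (f v ⊗ₜ b)) ∧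
  (∀ v, Y.str.lam (f v) = (LinearMap.lTensor P f) (X.str.lam v)) ∧
  (∀ v, Y.str.ρ (f v) = (LinearMap.rTensor H f) (X.str.ρ v))

instance : Category (PPHBMod π coactB) where
  Hom X Y := {f : X.V →ₗ[k] Y.V // Pres X Y f}
  id X := ⟨LinearMap.id, fun _ _ => rfl, fun _ _ => rfl,
    fun v => by simp [LinearMap.lTensor_id], fun v => by simp [LinearMap.rTensor_id]⟩
  comp {X Y Z} f g := ⟨g.1 ∘ₗ f.1, by
    obtain ⟨f, hf1, hf2, hf3, hf4⟩ := f
    obtain ⟨g, hg1, hg2, hg3, hg4⟩ := g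
    refine ⟨fun p v => ?_, fun v b => ?_, fun v => ?_, fun v => ?_⟩
    · simp [hf1, hg1]
    · simp [hf2, hg2]
    · simp only [LinearMap.comp_apply]
      rw [hg3, hf3, ← LinearMap.comp_apply, ← LinearMap.lTensor_comp]
    · simp only [LinearMap.comp_apply]
      rw [hg4, hf4, ← LinearMap.comp_apply, ← LinearMap.rTensor_comp]⟩
  id_comp f := Subtype.ext (LinearMap.comp_id _)
  comp_id f := Subtype.ext (LinearMap.id_comp _)
  assoc f g h := Subtype.ext rfl

end PPHBMod

section Coactions
variable {k P H V : Type} [Field k] [Ring P] [HopfAlgebra k P] [Ring H] [HopfAlgebra k H]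
variable [AddCommGroup V] [Module k V]

lemma piCoact_one (π : P →ₐc[k] H) : piCoact π 1 = 1 ⊗ₜ 1 := by
  simp [piCoact, Algebra.TensorProduct.one_def]

lemma piCoact_mul (π : P →ₐc[k] H) (p q : P) :
    piCoact π (p * q) = piCoact π p * piCoact π q := by
  simp only [piCoact, LinearMap.comp_apply, lTensor_pi_eq, AlgHom.toLinearMap_apply,
    Bialgebra.comul_mul, map_mul]

lemma piCoact_coassoc_comul (π : P →ₐc[k] H) (p : P) :
    TensorProduct.assoc k P P H (LinearMap.rTensor H Coalgebra.comul (piCoact π p)) =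
      LinearMap.lTensor P (piCoact π) (Coalgebra.comul p) := by
  rw [piCoact, LinearMap.lTensor_comp_apply, ← Coalgebra.coassoc_apply, LinearMap.comp_apply]
  generalize (Coalgebra.comul (R := k) p) = t
  induction t using TensorProduct.induction_on with
  | zero => simp
  | add x y hx hy => simp only [map_add, hx, hy]
  | tmul a b =>
    simp only [LinearMap.lTensor_tmul, LinearMap.rTensor_tmul]
    generalize (Coalgebra.comul (R := k) a) = t
    induction t using TensorProduct.induction_on with
    | zero => simp
    | add x y hx hy => simp only [map_add, add_tmul, hx, hy]
    | tmul a b => simp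

lemma piCoact_isRightCoaction (π : P →ₐc[k] H) : IsRightCoaction (piCoact π) := by
  constructor
  · intro p
    rw [piCoact, LinearMap.comp_apply, ← LinearMap.lTensor_comp_apply]
    have : Coalgebra.counit ∘ₗ (π : P →ₗ[k] H) = Coalgebra.counit (R := k) (A := P) := by
      ext x; simp
    rw [this]
    simp
  · intro p
    rw [LinearEquiv.eq_symm_apply]
    conv_lhs => rw [piCoact, LinearMap.rTensor_comp_apply]
    have h : ∀ t : (P ⊗[k] P) ⊗[k] H,
        TensorProduct.assoc k P H H (LinearMap.rTensor H (LinearMap.lTensor P (π : P →ₗ[k] H)) t)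
          = LinearMap.lTensor P (LinearMap.rTensor H (π : P →ₗ[k] H))
            (TensorProduct.assoc k P P H t) := fun t =>
      LinearMap.congr_fun (f := (TensorProduct.assoc k P H H).toLinearMap ∘ₗ
          (LinearMap.rTensor H (LinearMap.lTensor P (π : P →ₗ[k] H))))
        (g := LinearMap.lTensor P (LinearMap.rTensor H (π : P →ₗ[k] H)) ∘ₗ
            (TensorProduct.assoc k P P H).toLinearMap) (by ext; simp) t
    rw [h, ← piCoact, piCoact_coassoc_comul, piCoact, LinearMap.comp_apply,
      ← LinearMap.lTensor_comp_apply, ← LinearMap.lTensor_comp_apply]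
    congr 2
    ext x
    simp only [LinearMap.comp_apply]
    rw [← LinearMap.comp_apply, LinearMap.rTensor_comp_lTensor]
    exact CoalgHomClass.map_comp_comul_apply π x

variable {W : Type} [AddCommGroup W] [Module k W]

lemma lTensor_lTensor_assoc_comul (f : V →ₗ[k] W) (t : P ⊗[k] V) :
    LinearMap.lTensor P (LinearMap.lTensor P f)
        (TensorProduct.assoc k P P V (LinearMap.rTensor V Coalgebra.comul t)) =
      TensorProduct.assoc k P P W
        (LinearMap.rTensor W Coalgebra.comul (LinearMap.lTensor P f t)) := by
  induction t using TensorProduct.induction_on with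
  | zero => simp
  | add x y hx hy => simp only [map_add, hx, hy]
  | tmul a b =>
    simp only [LinearMap.lTensor_tmul, LinearMap.rTensor_tmul]
    generalize (Coalgebra.comul (R := k) a) = t
    induction t using TensorProduct.induction_on with
    | zero => simp
    | add x y hx hy => simp only [map_add, add_tmul, hx, hy]
    | tmul a b => simp

/-- A subspace of `P` stable under the left comultiplication is a left `P`-comodule. -/
lemma isLeftCoaction_of_comp_eq_comul {i : V →ₗ[k] P} (hi : Function.Injective i)
    {c : V →ₗ[k] P ⊗[k] V} (hc : LinearMap.lTensor P i ∘ₗ c = Coalgebra.comul ∘ₗ i) :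
    IsLeftCoaction c := by
  have hc' (v : V) : LinearMap.lTensor P i (c v) = Coalgebra.comul (i v) :=
    LinearMap.congr_fun hc v
  constructor
  · intro v
    apply hi
    have h (t : P ⊗[k] V) :
        i (TensorProduct.lid k _ (LinearMap.rTensor _ Coalgebra.counit t)) =
        TensorProduct.lid k _ (LinearMap.rTensor _ Coalgebra.counit
          (LinearMap.lTensor P i t)) := by
      induction t using TensorProduct.induction_on with
      | zero => simp
      | add x y hx hy => simp only [map_add, hx, hy]
      | tmul a b => simp
    rw [h, hc']
    simp
  · intro v
    apply Module.Flat.lTensor_preserves_injective_linearMap (M := P) _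
      (Module.Flat.lTensor_preserves_injective_linearMap (M := P) _ hi)
    rw [← LinearMap.lTensor_comp_apply, hc, LinearMap.lTensor_comp_apply, hc',
      ← Coalgebra.coassoc_apply, ← hc']
    exact (lTensor_lTensor_assoc_comul _ _).symm

/-- `S(v₍₋₂₎) ▷ (v₍₋₁₎ ▷ h(v₍₀₎)) = h(v)`. -/
lemma antipode_act_act {lam : V →ₗ[k] P ⊗[k] V} (hl : IsLeftCoaction lam)
    {act : P ⊗[k] W →ₗ[k] W} (ha : IsLeftAction act) (h : V →ₗ[k] W) (v : V) :
    act (TensorProduct.map (HopfAlgebra.antipode k)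
      (act ∘ₗ LinearMap.lTensor P h ∘ₗ lam) (lam v)) = h v := by
  have e : TensorProduct.map (HopfAlgebra.antipode k) (act ∘ₗ LinearMap.lTensor P h ∘ₗ lam) (lam v)
      = TensorProduct.map (HopfAlgebra.antipode k) (act ∘ₗ LinearMap.lTensor P h)
        (LinearMap.lTensor P lam (lam v)) := by
    rw [← LinearMap.comp_apply _ (LinearMap.lTensor P lam), LinearMap.map_comp_lTensor]; rfl
  conv_rhs => rw [← hl.1 v]
  rw [e, hl.2]
  generalize lam v = t
  induction t using TensorProduct.induction_on with
  | zero => simp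
  | add x y hx hy => simp only [map_add, hx, hy]
  | tmul p v =>
    simp only [LinearMap.rTensor_tmul, TensorProduct.lid_tmul, map_smul]
    have key := congrArg (fun a => act (a ⊗ₜ h v))
      (HopfAlgebra.mul_antipode_rTensor_comul_apply (R := k) p)
    simp only [Algebra.algebraMap_eq_smul_one, ← TensorProduct.smul_tmul', map_smul, ha.1] at key
    rw [← key]
    generalize (Coalgebra.comul (R := k) p) = t
    induction t using TensorProduct.induction_on with
    | zero => simp
    | add x y hx hy => simp only [map_add, add_tmul, hx, hy]
    | tmul a b => simp [ha.2]

/-- `v₍₋₂₎ ▷ (S(v₍₋₁₎) ▷ h(v₍₀₎)) = h(v)`. -/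
lemma act_antipode_act {lam : V →ₗ[k] P ⊗[k] V} (hl : IsLeftCoaction lam)
    {act : P ⊗[k] W →ₗ[k] W} (ha : IsLeftAction act) (h : V →ₗ[k] W) (v : V) :
    act (LinearMap.lTensor P (act ∘ₗ TensorProduct.map (HopfAlgebra.antipode k) h ∘ₗ lam) (lam v))
      = h v := by
  conv_rhs => rw [← hl.1 v]
  rw [← LinearMap.comp_assoc, LinearMap.lTensor_comp_apply, hl.2]
  generalize lam v = t
  induction t using TensorProduct.induction_on with
  | zero => simp
  | add x y hx hy => simp only [map_add, hx, hy]
  | tmul p v =>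
    simp only [LinearMap.rTensor_tmul, TensorProduct.lid_tmul, map_smul]
    have key := congrArg (fun a => act (a ⊗ₜ h v))
      (HopfAlgebra.mul_antipode_lTensor_comul_apply (R := k) p)
    simp only [Algebra.algebraMap_eq_smul_one, ← TensorProduct.smul_tmul', map_smul, ha.1] at key
    rw [← key]
    generalize (Coalgebra.comul (R := k) p) = t
    induction t using TensorProduct.induction_on with
    | zero => simp
    | add x y hx hy => simp only [map_add, add_tmul, hx, hy]
    | tmul a b => simp [ha.2]

end Coactions

section RestrictedComul
variable {k P H : Type} [Field k] [Ring P] [HopfAlgebra k P] [Ring H] [HopfAlgebra k H]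
variable {π : P →ₐc[k] H} {c : (qhsAlg π) →ₗ[k] P ⊗[k] (qhsAlg π)}

lemma qhsIncl_injective : Function.Injective (qhsIncl π) := Subtype.val_injective

lemma lTensor_qhsIncl_injective : Function.Injective (LinearMap.lTensor P (qhsIncl π)) :=
  Module.Flat.lTensor_preserves_injective_linearMap _ qhsIncl_injective

lemma IsRestrictedComul.apply (hc : IsRestrictedComul π c) (b : qhsAlg π) :
    LinearMap.lTensor P (qhsIncl π) (c b) = Coalgebra.comul (R := k) (b : P) :=
  LinearMap.congr_fun hc b

lemma IsRestrictedComul.map_one (hc : IsRestrictedComul π c) : c 1 = 1 ⊗ₜ 1 := by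
  apply lTensor_qhsIncl_injective
  rw [hc.apply]
  simp [qhsIncl, Algebra.TensorProduct.one_def]

lemma IsRestrictedComul.map_mul (hc : IsRestrictedComul π c) (a b : qhsAlg π) :
    c (a * b) = c a * c b := by
  have h : LinearMap.lTensor P (qhsIncl π) =
      (Algebra.TensorProduct.map (AlgHom.id k P) (qhsAlg π).val).toLinearMap := by
    ext; simp [qhsIncl]
  apply lTensor_qhsIncl_injective
  conv_rhs => rw [h, AlgHom.toLinearMap_apply, _root_.map_mul, ← AlgHom.toLinearMap_apply,
    ← AlgHom.toLinearMap_apply, ← h]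
  simp only [hc.apply, Subalgebra.coe_mul, Bialgebra.comul_mul]

lemma IsRestrictedComul.isLeftCoaction (hc : IsRestrictedComul π c) : IsLeftCoaction c :=
  isLeftCoaction_of_comp_eq_comul qhsIncl_injective hc

end RestrictedComul

section FreeHopfModule
variable {k P H B X : Type} [Field k] [Ring P] [HopfAlgebra k P] [Ring H] [HopfAlgebra k H]
variable [Ring B] [Algebra k B] [AddCommGroup X] [Module k X]

/-- The map `(x ⊗ h) ⊗ b ↦ x ◁ b ⊗ h`. -/
def actLeg (ract : X ⊗[k] B →ₗ[k] X) : (X ⊗[k] H) ⊗[k] B →ₗ[k] X ⊗[k] H :=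
  (LinearMap.rTensor H ract) ∘ₗ
      (TensorProduct.assoc k X B H).symm.toLinearMap ∘ₗ
      (LinearMap.lTensor X (TensorProduct.comm k H B).toLinearMap) ∘ₗ
      (TensorProduct.assoc k X H B).toLinearMap

@[simp]
lemma actLeg_tmul (ract : X ⊗[k] B →ₗ[k] X) (x : X) (h : H) (b : B) :
    actLeg ract ((x ⊗ₜ h) ⊗ₜ b) = ract (x ⊗ₜ b) ⊗ₜ h := by
  simp [actLeg]

/-- The map `p ⊗ b ↦ (x ◁ b)₍₀₎ ⊗ π(p)(x ◁ b)₍₁₎`. -/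
def crossedMap (π : P →ₐc[k] H) (ract : X ⊗[k] B →ₗ[k] X) (ρ : X →ₗ[k] X ⊗[k] H) (x : X) :
    P ⊗[k] B →ₗ[k] X ⊗[k] H :=
  (LinearMap.lTensor X (LinearMap.mul' k H)) ∘ₗ
      (TensorProduct.leftComm k H X H).toLinearMap ∘ₗ
      (TensorProduct.map (π : P →ₗ[k] H) (ρ ∘ₗ ract ∘ₗ TensorProduct.mk k X B x))

variable (k P X) in
/-- The regular left action of `P` on `P ⊗ X`. -/
def freeLact : P ⊗[k] (P ⊗[k] X) →ₗ[k] P ⊗[k] X :=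
  LinearMap.rTensor X (LinearMap.mul' k P) ∘ₗ (TensorProduct.assoc k P P X).symm.toLinearMap

@[simp]
lemma freeLact_tmul (p q : P) (x : X) :
    freeLact k P X (p ⊗ₜ (q ⊗ₜ x)) = (p * q) ⊗ₜ x := by
  simp [freeLact]

variable (k P X) in
/-- The regular left coaction of `P` on `P ⊗ X`. -/
def freeLam : P ⊗[k] X →ₗ[k] P ⊗[k] (P ⊗[k] X) :=
  (TensorProduct.assoc k P P X).toLinearMap ∘ₗ LinearMap.rTensor X (Coalgebra.comul (R := k))

lemma freeLam_tmul (p : P) (x : X) :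
    freeLam k P X (p ⊗ₜ x) = TensorProduct.assoc k P P X (Coalgebra.comul p ⊗ₜ x) := rfl

/-- The tensor product right action `(p ⊗ x) ◁ b = p b₁ ⊗ x ◁ b₂` on `P ⊗ X`. -/
def freeRact (c : B →ₗ[k] P ⊗[k] B) (ract : X ⊗[k] B →ₗ[k] X) :
    (P ⊗[k] X) ⊗[k] B →ₗ[k] P ⊗[k] X :=
  TensorProduct.map (LinearMap.mul' k P) ract ∘ₗ
    (tensorTensorTensorComm k P X P B).toLinearMap ∘ₗ LinearMap.lTensor (P ⊗[k] X) c

lemma freeRact_tmul (c : B →ₗ[k] P ⊗[k] B) (ract : X ⊗[k] B →ₗ[k] X) (y : P ⊗[k] X) (b : B) :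
    freeRact c ract (y ⊗ₜ b) =
      TensorProduct.map (LinearMap.mul' k P) ract (tensorTensorTensorComm k P X P B (y ⊗ₜ c b)) :=
  rfl

/-- The tensor product right coaction `p ⊗ x ↦ p₁ ⊗ x₍₀₎ ⊗ π(p₂) x₍₁₎` on `P ⊗ X`. -/
def freeRho (π : P →ₐc[k] H) (ρ : X →ₗ[k] X ⊗[k] H) :
    P ⊗[k] X →ₗ[k] (P ⊗[k] X) ⊗[k] H :=
  LinearMap.lTensor (P ⊗[k] X) (LinearMap.mul' k H) ∘ₗ
    (tensorTensorTensorComm k P H X H).toLinearMap ∘ₗ TensorProduct.map (piCoact π) ρ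

lemma freeRho_tmul (π : P →ₐc[k] H) (ρ : X →ₗ[k] X ⊗[k] H) (p : P) (x : X) :
    freeRho π ρ (p ⊗ₜ x) = LinearMap.lTensor (P ⊗[k] X) (LinearMap.mul' k H)
      (tensorTensorTensorComm k P H X H (piCoact π p ⊗ₜ ρ x)) := rfl

variable {π : P →ₐc[k] H} {c : B →ₗ[k] P ⊗[k] B}
variable {ract : X ⊗[k] B →ₗ[k] X} {ρ : X →ₗ[k] X ⊗[k] H}

lemma freeLact_isLeftAction : IsLeftAction (freeLact k P X) := by
  constructor
  · intro y
    induction y using TensorProduct.induction_on with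
    | zero => simp
    | add x y hx hy => simp only [map_add, tmul_add, hx, hy]
    | tmul p x => simp
  · intro a b y
    induction y using TensorProduct.induction_on with
    | zero => simp
    | add x y hx hy => simp only [map_add, tmul_add, hx, hy]
    | tmul p x => simp [mul_assoc]

lemma freeLam_isLeftCoaction : IsLeftCoaction (freeLam k P X) := by
  constructor
  · intro y
    induction y using TensorProduct.induction_on with
    | zero => simp
    | add x y hx hy => simp only [map_add, hx, hy]
    | tmul p x =>
      have h (t : P ⊗[k] P) : TensorProduct.lid k _ (LinearMap.rTensor _ Coalgebra.counit
          (TensorProduct.assoc k P P X (t ⊗ₜ x))) =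
          TensorProduct.lid k P (LinearMap.rTensor P Coalgebra.counit t) ⊗ₜ x := by
        induction t using TensorProduct.induction_on with
        | zero => simp
        | add x y hx hy => simp only [map_add, add_tmul, hx, hy]
        | tmul a b => simp [smul_tmul']
      rw [freeLam_tmul, h]
      simp
  · intro y
    induction y using TensorProduct.induction_on with
    | zero => simp
    | add x y hx hy => simp only [map_add, hx, hy]
    | tmul p x =>
      have h₁ (t : P ⊗[k] P) : LinearMap.lTensor P (freeLam k P X)
          (TensorProduct.assoc k P P X (t ⊗ₜ x)) =
          LinearMap.lTensor P ((TensorProduct.assoc k P P X).toLinearMap ∘ₗ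
            (TensorProduct.mk k (P ⊗[k] P) X).flip x) (LinearMap.lTensor P Coalgebra.comul t) := by
        induction t using TensorProduct.induction_on with
        | zero => simp
        | add x y hx hy => simp only [map_add, add_tmul, hx, hy]
        | tmul a b => simp [freeLam_tmul]
      have h₂ (t : P ⊗[k] P) : TensorProduct.assoc k P P (P ⊗[k] X)
          (LinearMap.rTensor (P ⊗[k] X) Coalgebra.comul
            (TensorProduct.assoc k P P X (t ⊗ₜ x))) =
          LinearMap.lTensor P ((TensorProduct.assoc k P P X).toLinearMap ∘ₗ
            (TensorProduct.mk k (P ⊗[k] P) X).flip x)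
            (TensorProduct.assoc k P P P (LinearMap.rTensor P Coalgebra.comul t)) := by
        induction t using TensorProduct.induction_on with
        | zero => simp
        | add x y hx hy => simp only [map_add, add_tmul, hx, hy]
        | tmul a b =>
          simp only [assoc_tmul, LinearMap.rTensor_tmul]
          generalize (Coalgebra.comul (R := k) a) = t
          induction t using TensorProduct.induction_on with
          | zero => simp
          | add x y hx hy => simp only [map_add, add_tmul, hx, hy]
          | tmul a b => simp
      rw [freeLam_tmul, h₁, h₂, Coalgebra.coassoc_apply]

lemma freeRact_isRightAction (hc₁ : c 1 = 1 ⊗ₜ 1) (hc₂ : ∀ a b, c (a * b) = c a * c b)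
    (hr : IsRightAction ract) : IsRightAction (freeRact c ract) := by
  constructor
  · intro y
    induction y using TensorProduct.induction_on with
    | zero => simp
    | add x y hx hy => simp only [map_add, add_tmul, hx, hy]
    | tmul p x => simp [freeRact_tmul, hc₁, hr.1]
  · intro y a b
    induction y using TensorProduct.induction_on with
    | zero => simp
    | add x y hx hy => simp only [map_add, add_tmul, hx, hy]
    | tmul p x =>
      rw [freeRact_tmul, freeRact_tmul, freeRact_tmul, hc₂]
      generalize c a = t
      generalize c b = s
      induction t using TensorProduct.induction_on with
      | zero => simp
      | add x y hx hy => simp only [map_add, add_tmul, tmul_add, add_mul, hx, hy]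
      | tmul a b =>
        induction s using TensorProduct.induction_on with
        | zero => simp
        | add x y hx hy => simp only [map_add, tmul_add, mul_add, hx, hy]
        | tmul a' b' => simp [mul_assoc, hr.2]

lemma freeRho_isRightCoaction (hρ : IsRightCoaction ρ) : IsRightCoaction (freeRho π ρ) := by
  constructor
  · intro y
    induction y using TensorProduct.induction_on with
    | zero => simp
    | add x y hx hy => simp only [map_add, hx, hy]
    | tmul p x =>
      rw [freeRho_tmul]
      conv_rhs => rw [← hρ.1 x, ← (piCoact_isRightCoaction π).1 p]
      generalize piCoact π p = t
      generalize ρ x = u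
      induction t using TensorProduct.induction_on with
      | zero => simp
      | add x y hx hy => simp only [map_add, add_tmul, hx, hy]
      | tmul a b =>
        induction u using TensorProduct.induction_on with
        | zero => simp
        | add x y hx hy => simp only [map_add, tmul_add, hx, hy]
        | tmul a' b' => simp [smul_tmul', tmul_smul, smul_smul, mul_comm]
  · intro y
    induction y using TensorProduct.induction_on with
    | zero => simp
    | add x y hx hy => simp only [map_add, hx, hy]
    | tmul p x =>
      let T : ((P ⊗[k] H) ⊗[k] H) ⊗[k] ((X ⊗[k] H) ⊗[k] H) →ₗ[k] ((P ⊗[k] X) ⊗[k] H) ⊗[k] H :=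
        TensorProduct.map (LinearMap.lTensor (P ⊗[k] X) (LinearMap.mul' k H) ∘ₗ
          (tensorTensorTensorComm k P H X H).toLinearMap) (LinearMap.mul' k H) ∘ₗ
          (tensorTensorTensorComm k (P ⊗[k] H) H (X ⊗[k] H) H).toLinearMap
      have h₁ (t : P ⊗[k] H) (u : X ⊗[k] H) :
          LinearMap.rTensor H (freeRho π ρ) (LinearMap.lTensor (P ⊗[k] X) (LinearMap.mul' k H)
            (tensorTensorTensorComm k P H X H (t ⊗ₜ u))) =
          T (LinearMap.rTensor H (piCoact π) t ⊗ₜ LinearMap.rTensor H ρ u) := by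
        induction t using TensorProduct.induction_on with
        | zero => simp
        | add x y hx hy => simp only [map_add, add_tmul, hx, hy]
        | tmul a b =>
          induction u using TensorProduct.induction_on with
          | zero => simp
          | add x y hx hy => simp only [map_add, tmul_add, hx, hy]
          | tmul a' b' => simp [T, freeRho_tmul]
      have h₂ (t : P ⊗[k] H) (u : X ⊗[k] H) :
          (TensorProduct.assoc k (P ⊗[k] X) H H).symm
            (LinearMap.lTensor (P ⊗[k] X) Coalgebra.comul
            (LinearMap.lTensor (P ⊗[k] X) (LinearMap.mul' k H)
            (tensorTensorTensorComm k P H X H (t ⊗ₜ u)))) =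
          T ((TensorProduct.assoc k P H H).symm (LinearMap.lTensor P Coalgebra.comul t) ⊗ₜ
            (TensorProduct.assoc k X H H).symm (LinearMap.lTensor X Coalgebra.comul u)) := by
        induction t using TensorProduct.induction_on with
        | zero => simp
        | add x y hx hy => simp only [map_add, add_tmul, hx, hy]
        | tmul a b =>
          induction u using TensorProduct.induction_on with
          | zero => simp
          | add x y hx hy => simp only [map_add, tmul_add, hx, hy]
          | tmul a' b' =>
            simp only [tensorTensorTensorComm_tmul, LinearMap.lTensor_tmul, LinearMap.mul'_apply,
              Bialgebra.comul_mul]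
            generalize (Coalgebra.comul (R := k) b) = d
            generalize (Coalgebra.comul (R := k) b') = d'
            induction d using TensorProduct.induction_on with
            | zero => simp
            | add x y hx hy => simp only [map_add, add_tmul, tmul_add, add_mul, hx, hy]
            | tmul e f =>
              induction d' using TensorProduct.induction_on with
              | zero => simp
              | add x y hx hy => simp only [map_add, tmul_add, mul_add, hx, hy]
              | tmul e' f' => simp [T]
      rw [freeRho_tmul, h₁, h₂, hρ.2, (piCoact_isRightCoaction π).2]

lemma freeRact_freeLact (p : P) (y : P ⊗[k] X) (b : B) :
    freeRact c ract (freeLact k P X (p ⊗ₜ y) ⊗ₜ b) =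
      freeLact k P X (p ⊗ₜ freeRact c ract (y ⊗ₜ b)) := by
  rw [freeRact_tmul, freeRact_tmul]
  generalize c b = t
  induction y using TensorProduct.induction_on with
  | zero => simp
  | add x y hx hy => simp only [map_add, tmul_add, add_tmul, hx, hy]
  | tmul q x =>
    induction t using TensorProduct.induction_on with
    | zero => simp
    | add x y hx hy => simp only [map_add, tmul_add, hx, hy]
    | tmul a b => simp [mul_assoc]

lemma freeLam_freeRho (y : P ⊗[k] X) :
    LinearMap.rTensor H (freeLam k P X) (freeRho π ρ y) =
      (TensorProduct.assoc k P (P ⊗[k] X) H).symm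
        (LinearMap.lTensor P (freeRho π ρ) (freeLam k P X y)) := by
  induction y using TensorProduct.induction_on with
  | zero => simp
  | add x y hx hy => simp only [map_add, hx, hy]
  | tmul p x =>
    let T : ((P ⊗[k] P) ⊗[k] H) ⊗[k] (X ⊗[k] H) →ₗ[k] (P ⊗[k] (P ⊗[k] X)) ⊗[k] H :=
      TensorProduct.map (TensorProduct.assoc k P P X).toLinearMap (LinearMap.mul' k H) ∘ₗ
        (tensorTensorTensorComm k (P ⊗[k] P) H X H).toLinearMap
    have h₁ (t : P ⊗[k] H) (u : X ⊗[k] H) :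
        LinearMap.rTensor H (freeLam k P X) (LinearMap.lTensor (P ⊗[k] X) (LinearMap.mul' k H)
          (tensorTensorTensorComm k P H X H (t ⊗ₜ u))) =
        T (LinearMap.rTensor H Coalgebra.comul t ⊗ₜ u) := by
      induction t using TensorProduct.induction_on with
      | zero => simp
      | add x y hx hy => simp only [map_add, add_tmul, hx, hy]
      | tmul a b =>
        induction u using TensorProduct.induction_on with
        | zero => simp
        | add x y hx hy => simp only [map_add, tmul_add, hx, hy]
        | tmul a' b' => simp [T, freeLam_tmul]
    have h₂ (d : P ⊗[k] P) :
        (TensorProduct.assoc k P (P ⊗[k] X) H).symm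
          (LinearMap.lTensor P (freeRho π ρ) (TensorProduct.assoc k P P X (d ⊗ₜ x))) =
        T ((TensorProduct.assoc k P P H).symm (LinearMap.lTensor P (piCoact π) d) ⊗ₜ ρ x) := by
      induction d using TensorProduct.induction_on with
      | zero => simp
      | add x y hx hy => simp only [map_add, add_tmul, hx, hy]
      | tmul a b =>
        simp only [assoc_tmul, LinearMap.lTensor_tmul, freeRho_tmul]
        generalize piCoact π b = t
        generalize ρ x = u
        induction t using TensorProduct.induction_on with
        | zero => simp
        | add x y hx hy => simp only [map_add, add_tmul, tmul_add, hx, hy]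
        | tmul e f =>
          induction u using TensorProduct.induction_on with
          | zero => simp
          | add x y hx hy => simp only [map_add, tmul_add, hx, hy]
          | tmul a' b' => simp [T]
    rw [freeLam_tmul, h₂, freeRho_tmul, h₁, ← piCoact_coassoc_comul,
      LinearEquiv.symm_apply_apply]

lemma freeLam_freeLact : freeLam k P X ∘ₗ freeLact k P X =
    (TensorProduct.map (LinearMap.mul' k P) (freeLact k P X)) ∘ₗ
      (tensorTensorTensorComm k P P P (P ⊗[k] X)).toLinearMap ∘ₗ
      (TensorProduct.map (Coalgebra.comul (R := k) (A := P)) (freeLam k P X)) := by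
  refine TensorProduct.ext' fun p y => ?_
  induction y using TensorProduct.induction_on with
  | zero => simp
  | add x y hx hy => simp only [map_add, tmul_add, hx, hy]
  | tmul q x =>
    simp only [LinearMap.comp_apply, freeLact_tmul, freeLam_tmul, Bialgebra.comul_mul, map_tmul,
      LinearEquiv.coe_coe]
    generalize (Coalgebra.comul (R := k) p) = d
    generalize (Coalgebra.comul (R := k) q) = d'
    induction d using TensorProduct.induction_on with
    | zero => simp
    | add x y hx hy => simp only [map_add, add_tmul, add_mul, hx, hy]
    | tmul e f =>
      induction d' using TensorProduct.induction_on with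
      | zero => simp
      | add x y hx hy => simp only [map_add, add_tmul, tmul_add, mul_add, hx, hy]
      | tmul e' f' => simp

lemma freeRho_freeLact : freeRho π ρ ∘ₗ freeLact k P X =
    (TensorProduct.map (freeLact k P X) (LinearMap.mul' k H)) ∘ₗ
      (tensorTensorTensorComm k P H (P ⊗[k] X) H).toLinearMap ∘ₗ
      (TensorProduct.map (piCoact π) (freeRho π ρ)) := by
  refine TensorProduct.ext' fun p y => ?_
  induction y using TensorProduct.induction_on with
  | zero => simp
  | add x y hx hy => simp only [map_add, tmul_add, hx, hy]
  | tmul q x =>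
    simp only [LinearMap.comp_apply, freeLact_tmul, freeRho_tmul, piCoact_mul, map_tmul,
      LinearEquiv.coe_coe]
    generalize piCoact π p = d
    generalize piCoact π q = d'
    generalize ρ x = u
    induction d using TensorProduct.induction_on with
    | zero => simp
    | add x y hx hy => simp only [map_add, add_tmul, add_mul, hx, hy]
    | tmul e f =>
      induction d' using TensorProduct.induction_on with
      | zero => simp
      | add x y hx hy => simp only [map_add, add_tmul, tmul_add, mul_add, hx, hy]
      | tmul e' f' =>
        induction u using TensorProduct.induction_on with
        | zero => simp
        | add x y hx hy => simp only [map_add, tmul_add, hx, hy]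
        | tmul x h => simp [mul_assoc]

lemma freeLam_freeRact (hc : IsLeftCoaction c) : freeLam k P X ∘ₗ freeRact c ract =
    (TensorProduct.map (LinearMap.mul' k P) (freeRact c ract)) ∘ₗ
      (tensorTensorTensorComm k P (P ⊗[k] X) P B).toLinearMap ∘ₗ
      (TensorProduct.map (freeLam k P X) c) := by
  refine TensorProduct.ext' fun y b => ?_
  induction y using TensorProduct.induction_on with
  | zero => simp
  | add x y hx hy => simp only [map_add, add_tmul, hx, hy]
  | tmul p x =>
    let T : (P ⊗[k] P) ⊗[k] (P ⊗[k] (P ⊗[k] B)) →ₗ[k] P ⊗[k] (P ⊗[k] X) :=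
      TensorProduct.map (LinearMap.mul' k P)
        (TensorProduct.map (LinearMap.mul' k P) (ract ∘ₗ TensorProduct.mk k X B x) ∘ₗ
          (TensorProduct.assoc k P P B).symm.toLinearMap) ∘ₗ
        (tensorTensorTensorComm k P P P (P ⊗[k] B)).toLinearMap
    have h₁ (t : P ⊗[k] B) : freeLam k P X (TensorProduct.map (LinearMap.mul' k P) ract
        (tensorTensorTensorComm k P X P B ((p ⊗ₜ x) ⊗ₜ t))) =
        T (Coalgebra.comul p ⊗ₜ
          TensorProduct.assoc k P P B (LinearMap.rTensor B Coalgebra.comul t)) := by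
      induction t using TensorProduct.induction_on with
      | zero => simp
      | add x y hx hy => simp only [map_add, tmul_add, hx, hy]
      | tmul q b =>
        simp only [tensorTensorTensorComm_tmul, map_tmul, LinearMap.mul'_apply, freeLam_tmul,
          Bialgebra.comul_mul, LinearMap.rTensor_tmul]
        generalize (Coalgebra.comul (R := k) p) = d
        generalize (Coalgebra.comul (R := k) q) = d'
        induction d using TensorProduct.induction_on with
        | zero => simp
        | add x y hx hy => simp only [map_add, add_tmul, add_mul, hx, hy]
        | tmul e f =>
          induction d' using TensorProduct.induction_on with
          | zero => simp
          | add x y hx hy => simp only [map_add, add_tmul, tmul_add, mul_add, hx, hy]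
          | tmul e' f' => simp [T]
    have h₂ (d : P ⊗[k] P) (t : P ⊗[k] B) :
        TensorProduct.map (LinearMap.mul' k P) (freeRact c ract)
          (tensorTensorTensorComm k P (P ⊗[k] X) P B
            (TensorProduct.assoc k P P X (d ⊗ₜ x) ⊗ₜ t)) =
        T (d ⊗ₜ LinearMap.lTensor P c t) := by
      induction d using TensorProduct.induction_on with
      | zero => simp
      | add x y hx hy => simp only [map_add, add_tmul, hx, hy]
      | tmul e f =>
        induction t using TensorProduct.induction_on with
        | zero => simp
        | add x y hx hy => simp only [map_add, tmul_add, hx, hy]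
        | tmul q b =>
          simp only [assoc_tmul, tensorTensorTensorComm_tmul, map_tmul, LinearMap.mul'_apply,
            freeRact_tmul, LinearMap.lTensor_tmul]
          generalize c b = t
          induction t using TensorProduct.induction_on with
          | zero => simp
          | add x y hx hy => simp only [map_add, tmul_add, hx, hy]
          | tmul q b => simp [T]
    simp only [LinearMap.comp_apply, map_tmul, LinearEquiv.coe_coe]
    rw [freeLam_tmul, h₂, freeRact_tmul, h₁, hc.2]

lemma freeRho_freeRact (hc : IsLeftCoaction c)
    (hX : ∀ x b, actLeg ract (ρ x ⊗ₜ b) = crossedMap π ract ρ x (c b)) :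
    freeRho π ρ ∘ₗ freeRact c ract =
      actLeg (freeRact c ract) ∘ₗ LinearMap.rTensor B (freeRho π ρ) := by
  refine TensorProduct.ext' fun y b => ?_
  induction y using TensorProduct.induction_on with
  | zero => simp
  | add x y hx hy => simp only [map_add, add_tmul, hx, hy]
  | tmul p x =>
    simp only [LinearMap.comp_apply, freeRact_tmul, LinearMap.rTensor_tmul, freeRho_tmul]
    let T : (P ⊗[k] H) ⊗[k] (P ⊗[k] (X ⊗[k] H)) →ₗ[k] (P ⊗[k] X) ⊗[k] H :=
      (TensorProduct.assoc k P X H).symm.toLinearMap ∘ₗ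
        TensorProduct.map (LinearMap.mul' k P) (LinearMap.lTensor X (LinearMap.mul' k H) ∘ₗ
          (TensorProduct.leftComm k H X H).toLinearMap) ∘ₗ
        (tensorTensorTensorComm k P H P (X ⊗[k] H)).toLinearMap
    have h₁ (t : P ⊗[k] B) : freeRho π ρ (TensorProduct.map (LinearMap.mul' k P) ract
        (tensorTensorTensorComm k P X P B ((p ⊗ₜ x) ⊗ₜ t))) =
        T (piCoact π p ⊗ₜ LinearMap.lTensor P (crossedMap π ract ρ x)
          (TensorProduct.assoc k P P B (LinearMap.rTensor B Coalgebra.comul t))) := by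
      induction t using TensorProduct.induction_on with
      | zero => simp
      | add x y hx hy => simp only [map_add, tmul_add, hx, hy]
      | tmul q b =>
        simp only [tensorTensorTensorComm_tmul, map_tmul, LinearMap.mul'_apply, freeRho_tmul,
          piCoact_mul, LinearMap.rTensor_tmul]
        generalize piCoact π p = t
        rw [piCoact, LinearMap.comp_apply]
        generalize (Coalgebra.comul (R := k) q) = d
        induction t using TensorProduct.induction_on with
        | zero => simp
        | add x y hx hy => simp only [map_add, add_tmul, add_mul, hx, hy]
        | tmul e f =>
          induction d using TensorProduct.induction_on with
          | zero => simp
          | add x y hx hy => simp only [map_add, add_tmul, tmul_add, mul_add, hx, hy]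
          | tmul e' f' =>
            simp only [crossedMap, LinearMap.lTensor_tmul, assoc_tmul, LinearMap.comp_apply,
              map_tmul, TensorProduct.mk_apply, Algebra.TensorProduct.tmul_mul_tmul]
            generalize ρ (ract (x ⊗ₜ b)) = u
            induction u using TensorProduct.induction_on with
            | zero => simp
            | add x y hx hy => simp only [map_add, tmul_add, hx, hy]
            | tmul x h => simp [T, mul_assoc]
    have h₂ (t : P ⊗[k] H) (u : X ⊗[k] H) :
        actLeg (freeRact c ract) (LinearMap.lTensor (P ⊗[k] X) (LinearMap.mul' k H)
          (tensorTensorTensorComm k P H X H (t ⊗ₜ u)) ⊗ₜ b) =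
        T (t ⊗ₜ LinearMap.lTensor P (actLeg ract ∘ₗ TensorProduct.mk k (X ⊗[k] H) B u) (c b)) := by
      induction t using TensorProduct.induction_on with
      | zero => simp
      | add x y hx hy => simp only [map_add, add_tmul, hx, hy]
      | tmul e f =>
        induction u using TensorProduct.induction_on with
        | zero => simp
        | add x y hx hy =>
          simp only [map_add, add_tmul, tmul_add, LinearMap.comp_add, LinearMap.lTensor_add,
            LinearMap.add_apply, hx, hy]
        | tmul x h =>
          simp only [tensorTensorTensorComm_tmul, LinearMap.lTensor_tmul, LinearMap.mul'_apply,
            actLeg_tmul, freeRact_tmul]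
          generalize c b = s
          induction s using TensorProduct.induction_on with
          | zero => simp
          | add x y hx hy => simp only [map_add, add_tmul, tmul_add, hx, hy]
          | tmul q b => simp [T]
    have h₃ : actLeg ract ∘ₗ TensorProduct.mk k (X ⊗[k] H) B (ρ x) =
        crossedMap π ract ρ x ∘ₗ c := LinearMap.ext fun b => hX x b
    rw [h₁, h₂, h₃, LinearMap.lTensor_comp_apply, hc.2]

end FreeHopfModule

section FreeFunctor
variable {k P H : Type} [Field k] [Ring P] [HopfAlgebra k P] [Ring H] [HopfAlgebra k H]
variable {π : P →ₐc[k] H} {c : (qhsAlg π) →ₗ[k] P ⊗[k] (qhsAlg π)}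

lemma isCrossedPair_iff {X : Type} [AddCommGroup X] [Module k X]
    {ract : X ⊗[k] (qhsAlg π) →ₗ[k] X} {ρ : X →ₗ[k] X ⊗[k] H} :
    IsCrossedPair π c ract ρ ↔
      ∀ x b, actLeg ract (ρ x ⊗ₜ b) = crossedMap π ract ρ x (c b) := by
  have h (x : X) (t : P ⊗[k] (qhsAlg π)) :
      TensorProduct.map (π : P →ₗ[k] H) (ρ ∘ₗ ract)
        (TensorProduct.leftComm k X P (qhsAlg π) (x ⊗ₜ t)) =
      TensorProduct.map (π : P →ₗ[k] H)
        (ρ ∘ₗ ract ∘ₗ TensorProduct.mk k X (qhsAlg π) x) t := by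
    induction t using TensorProduct.induction_on with
    | zero => rw [tmul_zero]; simp only [map_zero]
    | add x y hx hy => simp only [map_add, tmul_add, hx, hy]
    | tmul a b => rfl
  constructor
  · intro hX x b
    have := LinearMap.congr_fun hX (x ⊗ₜ b)
    simp only [LinearMap.comp_apply, LinearEquiv.coe_coe, LinearMap.lTensor_tmul,
      LinearMap.rTensor_tmul, h] at this
    exact this
  · intro hX
    refine TensorProduct.ext' fun x b => ?_
    simp only [LinearMap.comp_apply, LinearEquiv.coe_coe, LinearMap.lTensor_tmul,
      LinearMap.rTensor_tmul, h]
    exact hX x b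

/-- The Hopf module `P ⊗ X` of a crossed module `X`. -/
def freeObj (hc : IsRestrictedComul π c) (X : CrossedMod π c) : PPHBMod π c where
  V := P ⊗[k] X.V
  str :=
    { lact := freeLact k P X.V
      ract := freeRact c X.ract
      lam := freeLam k P X.V
      ρ := freeRho π X.ρ
      lact_action := freeLact_isLeftAction
      ract_action := freeRact_isRightAction hc.map_one hc.map_mul X.ract_action
      lam_coaction := freeLam_isLeftCoaction
      ρ_coaction := freeRho_isRightCoaction X.ρ_coaction
      acts_comm := freeRact_freeLact
      coacts_comm := freeLam_freeRho
      lact_lam := freeLam_freeLact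
      lact_ρ := freeRho_freeLact
      ract_lam := freeLam_freeRact hc.isLeftCoaction
      ract_ρ := freeRho_freeRact hc.isLeftCoaction (isCrossedPair_iff.mp X.crossed) }

section Maps
variable {B X X' : Type} [Ring B] [Algebra k B] [AddCommGroup X] [Module k X]
  [AddCommGroup X'] [Module k X']

lemma lTensor_freeLact (f : X →ₗ[k] X') (p : P) (y : P ⊗[k] X) :
    LinearMap.lTensor P f (freeLact k P X (p ⊗ₜ y)) =
      freeLact k P X' (p ⊗ₜ LinearMap.lTensor P f y) := by
  induction y using TensorProduct.induction_on with
  | zero => simp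
  | add x y hx hy => simp only [map_add, tmul_add, hx, hy]
  | tmul q x => simp

lemma lTensor_freeRact {c : B →ₗ[k] P ⊗[k] B} {ract : X ⊗[k] B →ₗ[k] X}
    {ract' : X' ⊗[k] B →ₗ[k] X'} (f : X →ₗ[k] X')
    (hf : ∀ x b, f (ract (x ⊗ₜ b)) = ract' (f x ⊗ₜ b)) (y : P ⊗[k] X) (b : B) :
    LinearMap.lTensor P f (freeRact c ract (y ⊗ₜ b)) =
      freeRact c ract' (LinearMap.lTensor P f y ⊗ₜ b) := by
  rw [freeRact_tmul, freeRact_tmul]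
  generalize c b = t
  induction y using TensorProduct.induction_on with
  | zero => simp
  | add x y hx hy => simp only [map_add, add_tmul, hx, hy]
  | tmul q x =>
    induction t using TensorProduct.induction_on with
    | zero => simp
    | add x y hx hy => simp only [map_add, tmul_add, hx, hy]
    | tmul a b => simp [hf]

lemma freeLam_lTensor (f : X →ₗ[k] X') (y : P ⊗[k] X) :
    freeLam k P X' (LinearMap.lTensor P f y) =
      LinearMap.lTensor P (LinearMap.lTensor P f) (freeLam k P X y) :=
  (lTensor_lTensor_assoc_comul f y).symm

lemma freeRho_lTensor {ρ : X →ₗ[k] X ⊗[k] H} {ρ' : X' →ₗ[k] X' ⊗[k] H} (f : X →ₗ[k] X')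
    (hf : ∀ x, ρ' (f x) = LinearMap.rTensor H f (ρ x)) (y : P ⊗[k] X) :
    freeRho π ρ' (LinearMap.lTensor P f y) =
      LinearMap.rTensor H (LinearMap.lTensor P f) (freeRho π ρ y) := by
  induction y using TensorProduct.induction_on with
  | zero => simp
  | add x y hx hy => simp only [map_add, hx, hy]
  | tmul p x =>
    rw [LinearMap.lTensor_tmul, freeRho_tmul, freeRho_tmul, hf]
    generalize piCoact π p = t
    generalize ρ x = u
    induction t using TensorProduct.induction_on with
    | zero => simp
    | add x y hx hy => simp only [map_add, add_tmul, hx, hy]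
    | tmul a b =>
      induction u using TensorProduct.induction_on with
      | zero => simp
      | add x y hx hy => simp only [map_add, tmul_add, hx, hy]
      | tmul a' b' => simp

variable (k P X) in
/-- The map `ε ⊗ id : P ⊗ X → X`. -/
def counitLeg : P ⊗[k] X →ₗ[k] X :=
  (TensorProduct.lid k X).toLinearMap ∘ₗ LinearMap.rTensor X Coalgebra.counit

@[simp]
lemma counitLeg_tmul (p : P) (x : X) :
    counitLeg k P X (p ⊗ₜ x) = Coalgebra.counit (R := k) p • x := by
  simp [counitLeg]

lemma counitLeg_lTensor (f : X →ₗ[k] X') (y : P ⊗[k] X) :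
    counitLeg k P X' (LinearMap.lTensor P f y) = f (counitLeg k P X y) := by
  induction y using TensorProduct.induction_on with
  | zero => simp
  | add x y hx hy => simp only [map_add, hx, hy]
  | tmul p x => simp

lemma eq_one_tmul_of_freeLam_eq {y : P ⊗[k] X} (hy : freeLam k P X y = 1 ⊗ₜ y) :
    y = 1 ⊗ₜ counitLeg k P X y := by
  have h (y : P ⊗[k] X) : LinearMap.lTensor P (counitLeg k P X) (freeLam k P X y) = y := by
    induction y using TensorProduct.induction_on with
    | zero => simp
    | add x y hx hy => simp only [map_add, hx, hy]
    | tmul p x =>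
      have h' (d : P ⊗[k] P) : LinearMap.lTensor P (counitLeg k P X)
          (TensorProduct.assoc k P P X (d ⊗ₜ x)) =
          TensorProduct.rid k P (LinearMap.lTensor P Coalgebra.counit d) ⊗ₜ x := by
        induction d using TensorProduct.induction_on with
        | zero => simp
        | add x y hx hy => simp only [map_add, add_tmul, hx, hy]
        | tmul a b => simp [smul_tmul']
      rw [freeLam_tmul, h']
      simp
  conv_lhs => rw [← h y, hy, LinearMap.lTensor_tmul]

lemma freeRact_one_tmul {c : B →ₗ[k] P ⊗[k] B} (ract : X ⊗[k] B →ₗ[k] X) (x : X) (b : B) :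
    freeRact c ract ((1 ⊗ₜ x) ⊗ₜ b) =
      LinearMap.lTensor P (ract ∘ₗ TensorProduct.mk k X B x) (c b) := by
  rw [freeRact_tmul]
  generalize c b = t
  induction t using TensorProduct.induction_on with
  | zero => simp
  | add x y hx hy => simp only [map_add, tmul_add, hx, hy]
  | tmul a b => simp

lemma freeRho_one_tmul (ρ : X →ₗ[k] X ⊗[k] H) (x : X) :
    freeRho π ρ (1 ⊗ₜ x) = LinearMap.rTensor H (TensorProduct.mk k P X 1) (ρ x) := by
  rw [freeRho_tmul, piCoact_one]
  generalize ρ x = t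
  induction t using TensorProduct.induction_on with
  | zero => simp
  | add x y hx hy => simp only [map_add, tmul_add, hx, hy]
  | tmul a b => simp

lemma counitLeg_mk_one : counitLeg k P X ∘ₗ TensorProduct.mk k P X 1 = LinearMap.id := by
  ext; simp

lemma counitLeg_freeRact_one_tmul {c : B →ₗ[k] P ⊗[k] B} (hc : IsLeftCoaction c)
    (ract : X ⊗[k] B →ₗ[k] X) (x : X) (b : B) :
    counitLeg k P X (freeRact c ract ((1 ⊗ₜ x) ⊗ₜ b)) = ract (x ⊗ₜ b) := by
  rw [freeRact_one_tmul, counitLeg_lTensor]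
  exact congrArg (fun b => ract (x ⊗ₜ b)) (hc.1 b)

lemma rTensor_counitLeg_freeRho_one_tmul (ρ : X →ₗ[k] X ⊗[k] H) (x : X) :
    LinearMap.rTensor H (counitLeg k P X) (freeRho π ρ (1 ⊗ₜ x)) = ρ x := by
  rw [freeRho_one_tmul, ← LinearMap.rTensor_comp_apply, counitLeg_mk_one, LinearMap.rTensor_id,
    LinearMap.id_apply]

end Maps

/-- The functor `X ↦ P ⊗ X`. -/
def freeFunctor (hc : IsRestrictedComul π c) : CrossedMod π c ⥤ PPHBMod π c where
  obj := freeObj hc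
  map f := ⟨LinearMap.lTensor P f.1, lTensor_freeLact f.1, lTensor_freeRact f.1 f.2.1,
    freeLam_lTensor f.1, freeRho_lTensor f.1 f.2.2⟩
  map_id X := Subtype.ext (LinearMap.lTensor_id P X.V)
  map_comp f g := Subtype.ext (LinearMap.lTensor_comp P g.1 f.1)

lemma freeFunctor_faithful (hc : IsRestrictedComul π c) : (freeFunctor hc).Faithful where
  map_injective {X Y f g} h := Subtype.ext <| LinearMap.ext fun x => by
    have h' : LinearMap.lTensor P f.1 = LinearMap.lTensor P g.1 := congrArg Subtype.val h
    simpa [counitLeg_lTensor] using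
      congrArg (counitLeg k P Y.V) (LinearMap.congr_fun h' (1 ⊗ₜ x))

lemma freeFunctor_full (hc : IsRestrictedComul π c) : (freeFunctor hc).Full where
  map_surjective {X Y} g := by
    obtain ⟨g, hg₁, hg₂, hg₃, hg₄⟩ := g
    change P ⊗[k] X.V →ₗ[k] P ⊗[k] Y.V at g
    change ∀ p v, g (freeLact k P X.V (p ⊗ₜ v)) = freeLact k P Y.V (p ⊗ₜ g v) at hg₁
    change ∀ v b, g (freeRact c X.ract (v ⊗ₜ b)) = freeRact c Y.ract (g v ⊗ₜ b) at hg₂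
    change ∀ v, freeLam k P Y.V (g v) = LinearMap.lTensor P g (freeLam k P X.V v) at hg₃
    change ∀ v, freeRho π Y.ρ (g v) = LinearMap.rTensor H g (freeRho π X.ρ v) at hg₄
    let f : X.V →ₗ[k] Y.V := counitLeg k P Y.V ∘ₗ g ∘ₗ TensorProduct.mk k P X.V 1
    have hf (x : X.V) : g (1 ⊗ₜ x) = 1 ⊗ₜ f x := by
      refine eq_one_tmul_of_freeLam_eq ?_
      rw [hg₃, freeLam_tmul, Bialgebra.comul_one, Algebra.TensorProduct.one_def, assoc_tmul,
        LinearMap.lTensor_tmul]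
    have hgf : LinearMap.lTensor P f = g := TensorProduct.ext' fun p x => by
      have := hg₁ p (1 ⊗ₜ x)
      rw [hf, freeLact_tmul, freeLact_tmul, mul_one] at this
      rw [this, LinearMap.lTensor_tmul]
    refine ⟨⟨f, fun x b => ?_, fun x => ?_⟩, Subtype.ext hgf⟩
    · rw [← counitLeg_freeRact_one_tmul hc.isLeftCoaction Y.ract, ← hf, ← hg₂, ← hgf,
        counitLeg_lTensor, counitLeg_freeRact_one_tmul hc.isLeftCoaction]
    · rw [← rTensor_counitLeg_freeRho_one_tmul (π := π) Y.ρ, ← hf, hg₄, freeRho_one_tmul,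
        ← LinearMap.rTensor_comp_apply, ← LinearMap.rTensor_comp_apply, LinearMap.comp_assoc]

end FreeFunctor

section Coinvariants
variable {k P Y : Type} [Field k] [Ring P] [HopfAlgebra k P] [AddCommGroup Y] [Module k Y]

/-- The left coinvariants `ᴾY`. -/
def coinvariants (lam : Y →ₗ[k] P ⊗[k] Y) : Submodule k Y :=
  LinearMap.ker (lam - TensorProduct.mk k P Y 1)

lemma mem_coinvariants {lam : Y →ₗ[k] P ⊗[k] Y} {y : Y} :
    y ∈ coinvariants lam ↔ lam y = 1 ⊗ₜ y := by
  simp [coinvariants, sub_eq_zero]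

/-- The map `y ↦ S(y₍₋₁₎) ▷ y₍₀₎`. -/
def average (lact : P ⊗[k] Y →ₗ[k] Y) (lam : Y →ₗ[k] P ⊗[k] Y) : Y →ₗ[k] Y :=
  lact ∘ₗ LinearMap.rTensor Y (HopfAlgebra.antipode k) ∘ₗ lam

/-- The diagonal left action of `P` on `P ⊗ Y`. -/
def diagAct (lact : P ⊗[k] Y →ₗ[k] Y) : P ⊗[k] (P ⊗[k] Y) →ₗ[k] P ⊗[k] Y :=
  (TensorProduct.map (LinearMap.mul' k P) lact) ∘ₗ
      (tensorTensorTensorComm k P P P Y).toLinearMap ∘ₗ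
      LinearMap.rTensor (P ⊗[k] Y) Coalgebra.comul

lemma diagAct_tmul (lact : P ⊗[k] Y →ₗ[k] Y) (p : P) (z : P ⊗[k] Y) :
    diagAct lact (p ⊗ₜ z) = TensorProduct.map (LinearMap.mul' k P) lact
      (tensorTensorTensorComm k P P P Y (Coalgebra.comul p ⊗ₜ z)) := rfl

variable {lact : P ⊗[k] Y →ₗ[k] Y} {lam : Y →ₗ[k] P ⊗[k] Y}

lemma diagAct_isLeftAction (ha : IsLeftAction lact) : IsLeftAction (diagAct lact) := by
  constructor
  · intro z
    induction z using TensorProduct.induction_on with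
    | zero => simp
    | add x y hx hy => simp only [map_add, tmul_add, hx, hy]
    | tmul p x => simp [diagAct_tmul, Algebra.TensorProduct.one_def, ha.1]
  · intro a b z
    rw [diagAct_tmul, diagAct_tmul, diagAct_tmul, Bialgebra.comul_mul]
    generalize (Coalgebra.comul (R := k) a) = d
    generalize (Coalgebra.comul (R := k) b) = d'
    induction d using TensorProduct.induction_on with
    | zero => simp
    | add x y hx hy => simp only [map_add, add_tmul, add_mul, hx, hy]
    | tmul e f =>
      induction d' using TensorProduct.induction_on with
      | zero => simp
      | add x y hx hy => simp only [map_add, add_tmul, tmul_add, mul_add, hx, hy]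
      | tmul e' f' =>
        induction z using TensorProduct.induction_on with
        | zero => simp
        | add x y hx hy => simp only [map_add, tmul_add, hx, hy]
        | tmul p x => simp [mul_assoc, ha.2]

lemma lact_average (ha : IsLeftAction lact) (hl : IsLeftCoaction lam) (y : Y) :
    lact (LinearMap.lTensor P (average lact lam) (lam y)) = y :=
  act_antipode_act hl ha LinearMap.id y

lemma lam_eq_diagAct_average (ha : IsLeftAction lact) (hl : IsLeftCoaction lam) :
    diagAct lact ∘ₗ LinearMap.lTensor P (TensorProduct.mk k P Y 1 ∘ₗ average lact lam) ∘ₗ lam =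
      lam := by
  have h (t : P ⊗[k] Y) : diagAct lact (LinearMap.lTensor P (TensorProduct.mk k P Y 1) t) =
      LinearMap.lTensor P lact
        (TensorProduct.assoc k P P Y (LinearMap.rTensor Y Coalgebra.comul t)) := by
    induction t using TensorProduct.induction_on with
    | zero => simp
    | add x y hx hy => simp only [map_add, hx, hy]
    | tmul p y =>
      simp only [LinearMap.lTensor_tmul, LinearMap.rTensor_tmul, TensorProduct.mk_apply,
        diagAct_tmul]
      generalize (Coalgebra.comul (R := k) p) = d
      induction d using TensorProduct.induction_on with
      | zero => simp
      | add x y hx hy => simp only [map_add, add_tmul, hx, hy]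
      | tmul e f => simp
  ext y
  rw [LinearMap.comp_apply, LinearMap.comp_apply, LinearMap.lTensor_comp_apply, h,
    ← lTensor_lTensor_assoc_comul, ← hl.2, ← LinearMap.lTensor_comp_apply,
    ← LinearMap.lTensor_comp_apply]
  have : (lact ∘ₗ LinearMap.lTensor P (average lact lam)) ∘ₗ lam = LinearMap.id :=
    LinearMap.ext (lact_average ha hl)
  rw [this, LinearMap.lTensor_id, LinearMap.id_apply]

lemma lam_lact_apply (hall : lam ∘ₗ lact =
      (TensorProduct.map (LinearMap.mul' k P) lact) ∘ₗ
        (tensorTensorTensorComm k P P P Y).toLinearMap ∘ₗ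
        (TensorProduct.map (Coalgebra.comul (R := k) (A := P)) lam)) (t : P ⊗[k] Y) :
    lam (lact t) = diagAct lact (LinearMap.lTensor P lam t) := by
  have h : TensorProduct.map (Coalgebra.comul (R := k) (A := P)) lam =
      LinearMap.rTensor _ Coalgebra.comul ∘ₗ LinearMap.lTensor P lam := by
    ext; simp
  rw [← LinearMap.comp_apply, hall, h]
  rfl

lemma average_mem_coinvariants (ha : IsLeftAction lact) (hl : IsLeftCoaction lam)
    (hall : ∀ t, lam (lact t) = diagAct lact (LinearMap.lTensor P lam t)) (y : Y) :
    average lact lam y ∈ coinvariants lam := by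
  rw [mem_coinvariants]
  have := antipode_act_act hl (diagAct_isLeftAction ha)
    (TensorProduct.mk k P Y 1 ∘ₗ average lact lam) y
  rw [lam_eq_diagAct_average ha hl] at this
  conv_lhs => rw [average, LinearMap.comp_apply, hall, LinearMap.comp_apply,
    ← LinearMap.comp_apply (LinearMap.lTensor P lam), LinearMap.lTensor_comp_rTensor, this]
  rfl

lemma lam_lact_coinvariant {x : Y} (hx : lam x = 1 ⊗ₜ x)
    (hall : ∀ t, lam (lact t) = diagAct lact (LinearMap.lTensor P lam t)) (p : P) :
    lam (lact (p ⊗ₜ x)) =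
      LinearMap.lTensor P (lact ∘ₗ (TensorProduct.mk k P Y).flip x) (Coalgebra.comul p) := by
  rw [hall, LinearMap.lTensor_tmul, hx, diagAct_tmul]
  generalize (Coalgebra.comul (R := k) p) = d
  induction d using TensorProduct.induction_on with
  | zero => simp
  | add x y hx hy => simp only [map_add, add_tmul, hx, hy]
  | tmul e f => simp

lemma average_lact_coinvariant (ha : IsLeftAction lact) {x : Y} (hx : lam x = 1 ⊗ₜ x)
    (hall : ∀ t, lam (lact t) = diagAct lact (LinearMap.lTensor P lam t)) (p : P) :
    average lact lam (lact (p ⊗ₜ x)) = Coalgebra.counit (R := k) p • x := by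
  rw [average, LinearMap.comp_apply, LinearMap.comp_apply, lam_lact_coinvariant hx hall]
  have key := congrArg (fun a => lact (a ⊗ₜ x))
    (HopfAlgebra.mul_antipode_rTensor_comul_apply (R := k) p)
  simp only [Algebra.algebraMap_eq_smul_one, ← TensorProduct.smul_tmul', map_smul, ha.1] at key
  rw [← key]
  generalize (Coalgebra.comul (R := k) p) = t
  induction t using TensorProduct.induction_on with
  | zero => simp
  | add x y hx hy => simp only [map_add, add_tmul, hx, hy]
  | tmul a b => simp [ha.2]

lemma average_lact (ha : IsLeftAction lact) (hl : IsLeftCoaction lam)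
    (hall : ∀ t, lam (lact t) = diagAct lact (LinearMap.lTensor P lam t)) (p : P) (y : Y) :
    average lact lam (lact (p ⊗ₜ y)) = Coalgebra.counit (R := k) p • average lact lam y := by
  conv_lhs => rw [← lact_average ha hl y]
  conv_rhs => rw [← lact_average ha hl y]
  generalize lam y = t
  have h (y : Y) := mem_coinvariants.mp (average_mem_coinvariants ha hl hall y)
  induction t using TensorProduct.induction_on with
  | zero => simp
  | add x y hx hy => simp only [map_add, tmul_add, smul_add, hx, hy]
  | tmul q y =>
    rw [LinearMap.lTensor_tmul, ← ha.2, average_lact_coinvariant ha (h y) hall,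
      average_lact_coinvariant ha (h y) hall, Bialgebra.counit_mul, mul_smul]

lemma average_coinvariant (ha : IsLeftAction lact) {x : Y} (hx : lam x = 1 ⊗ₜ x) :
    average lact lam x = x := by
  simp [average, hx, ha.1]

end Coinvariants

section CoinvariantModule
variable {k P H B Y : Type} [Field k] [Ring P] [HopfAlgebra k P] [Ring H] [HopfAlgebra k H]
variable [Ring B] [Algebra k B] [AddCommGroup Y] [Module k Y]
variable {lact : P ⊗[k] Y →ₗ[k] Y} {lam : Y →ₗ[k] P ⊗[k] Y}

/-- The projection `Y → ᴾY`, `y ↦ S(y₍₋₁₎) ▷ y₍₀₎`. -/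
def toCoinvariants (h : ∀ y, average lact lam y ∈ coinvariants lam) :
    Y →ₗ[k] coinvariants lam :=
  (average lact lam).codRestrict _ h

/-- The right action `y ⋄ b = S(b₁) ▷ y ◁ b₂` on `ᴾY`. -/
def coinvRact (h : ∀ y, average lact lam y ∈ coinvariants lam) (ract : Y ⊗[k] B →ₗ[k] Y) :
    coinvariants lam ⊗[k] B →ₗ[k] coinvariants lam :=
  toCoinvariants h ∘ₗ ract ∘ₗ LinearMap.rTensor B (coinvariants lam).subtype

lemma coinvRact_tmul (h : ∀ y, average lact lam y ∈ coinvariants lam) (ract : Y ⊗[k] B →ₗ[k] Y)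
    (x : coinvariants lam) (b : B) :
    coinvRact h ract (x ⊗ₜ b) = toCoinvariants h (ract (x ⊗ₜ b)) := rfl

/-- The restriction of a right coaction to `ᴾY`. -/
def coinvRho (h : ∀ y, average lact lam y ∈ coinvariants lam) (ρ : Y →ₗ[k] Y ⊗[k] H) :
    coinvariants lam →ₗ[k] coinvariants lam ⊗[k] H :=
  LinearMap.rTensor H (toCoinvariants h) ∘ₗ ρ ∘ₗ (coinvariants lam).subtype

lemma coinvRho_apply (h : ∀ y, average lact lam y ∈ coinvariants lam) (ρ : Y →ₗ[k] Y ⊗[k] H)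
    (x : coinvariants lam) :
    coinvRho h ρ x = LinearMap.rTensor H (toCoinvariants h) (ρ x) := rfl

variable {h : ∀ y, average lact lam y ∈ coinvariants lam}

lemma subtype_comp_toCoinvariants :
    (coinvariants lam).subtype ∘ₗ toCoinvariants h = average lact lam := rfl

lemma toCoinvariants_coe (ha : IsLeftAction lact) (x : coinvariants lam) :
    toCoinvariants h x = x :=
  Subtype.ext (average_coinvariant ha (mem_coinvariants.mp x.2))

lemma toCoinvariants_lact (ha : IsLeftAction lact) (hl : IsLeftCoaction lam)
    (hall : ∀ t, lam (lact t) = diagAct lact (LinearMap.lTensor P lam t)) (p : P) (y : Y) :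
    toCoinvariants h (lact (p ⊗ₜ y)) = Coalgebra.counit (R := k) p • toCoinvariants h y :=
  Subtype.ext (average_lact ha hl hall p y)

lemma rTensor_subtype_coinvRho (ha : IsLeftAction lact) {ρ : Y →ₗ[k] Y ⊗[k] H}
    (hlρ : ∀ y, (LinearMap.rTensor H lam) (ρ y) =
      (TensorProduct.assoc k P Y H).symm ((LinearMap.lTensor P ρ) (lam y)))
    (x : coinvariants lam) :
    LinearMap.rTensor H (coinvariants lam).subtype (coinvRho h ρ x) = ρ x := by
  rw [coinvRho_apply, ← LinearMap.rTensor_comp_apply, subtype_comp_toCoinvariants, average,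
    ← LinearMap.comp_assoc, LinearMap.rTensor_comp_apply, hlρ, mem_coinvariants.mp x.2,
    LinearMap.lTensor_tmul]
  generalize ρ x = t
  induction t using TensorProduct.induction_on with
  | zero => simp
  | add x y hx hy => simp only [map_add, tmul_add, hx, hy]
  | tmul y b => simp [ha.1]

lemma coinvRho_isRightCoaction (ha : IsLeftAction lact) {ρ : Y →ₗ[k] Y ⊗[k] H}
    (hlρ : ∀ y, (LinearMap.rTensor H lam) (ρ y) =
      (TensorProduct.assoc k P Y H).symm ((LinearMap.lTensor P ρ) (lam y)))
    (hρ : IsRightCoaction ρ) : IsRightCoaction (coinvRho h ρ) := by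
  constructor
  · intro x
    apply Subtype.val_injective
    conv_rhs => rw [← hρ.1 x, ← rTensor_subtype_coinvRho (h := h) ha hlρ]
    generalize coinvRho h ρ x = t
    induction t using TensorProduct.induction_on with
    | zero => simp
    | add x y hx hy => simp only [map_add, Submodule.coe_add, hx, hy]
    | tmul y b => simp
  · intro x
    have h₁ : LinearMap.rTensor H (coinvRho h ρ) (coinvRho h ρ x) =
        LinearMap.rTensor H (LinearMap.rTensor H (toCoinvariants h))
          (LinearMap.rTensor H ρ (ρ x)) := by
      rw [← rTensor_subtype_coinvRho (h := h) ha hlρ, ← LinearMap.rTensor_comp_apply,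
        ← LinearMap.rTensor_comp_apply]
      rfl
    rw [h₁, hρ.2, coinvRho_apply]
    generalize ρ x = t
    induction t using TensorProduct.induction_on with
    | zero => simp
    | add x y hx hy => simp only [map_add, hx, hy]
    | tmul y b =>
      simp only [LinearMap.lTensor_tmul, LinearMap.rTensor_tmul]
      generalize (Coalgebra.comul (R := k) b) = d
      induction d using TensorProduct.induction_on with
      | zero => simp
      | add x y hx hy => simp only [map_add, tmul_add, hx, hy]
      | tmul e f => simp

lemma lact_lTensor_coinvRact (ha : IsLeftAction lact) (hl : IsLeftCoaction lam)
    {c : B →ₗ[k] P ⊗[k] B} {ract : Y ⊗[k] B →ₗ[k] Y}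
    (hrl : lam ∘ₗ ract = (TensorProduct.map (LinearMap.mul' k P) ract) ∘ₗ
      (tensorTensorTensorComm k P Y P B).toLinearMap ∘ₗ (TensorProduct.map lam c))
    (x : coinvariants lam) (b : B) :
    lact (LinearMap.lTensor P ((coinvariants lam).subtype ∘ₗ coinvRact h ract ∘ₗ
      TensorProduct.mk k _ B x) (c b)) = ract (x ⊗ₜ b) := by
  have h₁ : lam (ract (x ⊗ₜ b)) =
      LinearMap.lTensor P (ract ∘ₗ TensorProduct.mk k Y B x) (c b) := by
    rw [← LinearMap.comp_apply lam, hrl, LinearMap.comp_apply, LinearMap.comp_apply, map_tmul,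
      mem_coinvariants.mp x.2]
    generalize c b = t
    induction t using TensorProduct.induction_on with
    | zero => simp
    | add x y hx hy => simp only [map_add, tmul_add, hx, hy]
    | tmul e f => simp
  conv_rhs => rw [← lact_average ha hl (ract (x ⊗ₜ b)), h₁, ← LinearMap.lTensor_comp_apply]
  rfl

lemma coinvRact_isRightAction (ha : IsLeftAction lact) (hl : IsLeftCoaction lam)
    (hall : ∀ t, lam (lact t) = diagAct lact (LinearMap.lTensor P lam t))
    {c : B →ₗ[k] P ⊗[k] B} (hc : IsLeftCoaction c)
    {ract : Y ⊗[k] B →ₗ[k] Y} (hr : IsRightAction ract)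
    (hlr : ∀ (p : P) (y : Y) (b : B), ract (lact (p ⊗ₜ y) ⊗ₜ b) = lact (p ⊗ₜ ract (y ⊗ₜ b)))
    (hrl : lam ∘ₗ ract = (TensorProduct.map (LinearMap.mul' k P) ract) ∘ₗ
      (tensorTensorTensorComm k P Y P B).toLinearMap ∘ₗ (TensorProduct.map lam c)) :
    IsRightAction (coinvRact h ract) := by
  constructor
  · intro x
    rw [coinvRact_tmul, hr.1, toCoinvariants_coe ha]
  · intro x a b
    rw [coinvRact_tmul, hr.2, ← lact_lTensor_coinvRact (h := h) ha hl hrl]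
    conv_rhs => rw [← hc.1 a]
    generalize c a = t
    induction t using TensorProduct.induction_on with
    | zero => simp
    | add x y hx hy => simp only [map_add, tmul_add, add_tmul, hx, hy]
    | tmul e f =>
      rw [LinearMap.lTensor_tmul, hlr, toCoinvariants_lact ha hl hall, LinearMap.rTensor_tmul,
        TensorProduct.lid_tmul, tmul_smul, map_smul, ← smul_tmul', map_smul]
      rfl

lemma actLeg_coinvRact (ha : IsLeftAction lact) (hl : IsLeftCoaction lam)
    (hall : ∀ t, lam (lact t) = diagAct lact (LinearMap.lTensor P lam t))
    {c : B →ₗ[k] P ⊗[k] B} {π : P →ₐc[k] H}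
    {ract : Y ⊗[k] B →ₗ[k] Y} {ρ : Y →ₗ[k] Y ⊗[k] H}
    (hlρ : ∀ y, (LinearMap.rTensor H lam) (ρ y) =
      (TensorProduct.assoc k P Y H).symm ((LinearMap.lTensor P ρ) (lam y)))
    (hrl : lam ∘ₗ ract = (TensorProduct.map (LinearMap.mul' k P) ract) ∘ₗ
      (tensorTensorTensorComm k P Y P B).toLinearMap ∘ₗ (TensorProduct.map lam c))
    (hρl : ρ ∘ₗ lact = (TensorProduct.map lact (LinearMap.mul' k H)) ∘ₗ
      (tensorTensorTensorComm k P H Y H).toLinearMap ∘ₗ (TensorProduct.map (piCoact π) ρ))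
    (hρr : ρ ∘ₗ ract = actLeg ract ∘ₗ LinearMap.rTensor B ρ) (x : coinvariants lam) (b : B) :
    actLeg (coinvRact h ract) (coinvRho h ρ x ⊗ₜ b) =
      crossedMap π (coinvRact h ract) (coinvRho h ρ) x (c b) := by
  have h₁ (u : coinvariants lam ⊗[k] H) : actLeg (coinvRact h ract) (u ⊗ₜ b) =
      LinearMap.rTensor H (toCoinvariants h)
        (actLeg ract (LinearMap.rTensor H (coinvariants lam).subtype u ⊗ₜ b)) := by
    induction u using TensorProduct.induction_on with
    | zero => simp
    | add x y hx hy => simp only [map_add, add_tmul, hx, hy]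
    | tmul y g => simp [coinvRact_tmul]
  have h₂ : actLeg ract (ρ x ⊗ₜ b) = ρ (ract (x ⊗ₜ b)) := (LinearMap.congr_fun hρr (x ⊗ₜ b)).symm
  rw [h₁, rTensor_subtype_coinvRho ha hlρ, h₂, ← lact_lTensor_coinvRact (h := h) ha hl hrl]
  generalize c b = t
  induction t using TensorProduct.induction_on with
  | zero => simp
  | add x y hx hy => simp only [map_add, hx, hy]
  | tmul p b =>
    have h₃ (t : P ⊗[k] H) (u : Y ⊗[k] H) : LinearMap.rTensor H (toCoinvariants h)
        (TensorProduct.map lact (LinearMap.mul' k H)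
          (tensorTensorTensorComm k P H Y H (t ⊗ₜ u))) =
        LinearMap.lTensor _ (LinearMap.mul' k H)
          (TensorProduct.leftComm k H _ H
            (TensorProduct.lid k H (LinearMap.rTensor H Coalgebra.counit t) ⊗ₜ
              LinearMap.rTensor H (toCoinvariants h) u)) := by
      induction t using TensorProduct.induction_on with
      | zero => simp
      | add x y hx hy => simp only [map_add, add_tmul, hx, hy]
      | tmul e f =>
        induction u using TensorProduct.induction_on with
        | zero => simp
        | add x y hx hy => simp only [map_add, tmul_add, hx, hy]
        | tmul y g => simp [toCoinvariants_lact ha hl hall, smul_tmul]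
    have h₄ : TensorProduct.lid k H (LinearMap.rTensor H Coalgebra.counit (piCoact π p)) = π p := by
      rw [piCoact, LinearMap.comp_apply, ← LinearMap.comp_apply (LinearMap.rTensor _ _),
        LinearMap.rTensor_comp_lTensor, ← LinearMap.lTensor_comp_rTensor, LinearMap.comp_apply]
      simp
    rw [LinearMap.lTensor_tmul, ← LinearMap.comp_apply ρ, hρl, LinearMap.comp_apply,
      LinearMap.comp_apply, map_tmul, LinearEquiv.coe_coe, h₃, h₄]
    rfl

/-- The fundamental isomorphism `P ⊗ ᴾY ≃ Y` of Hopf modules. -/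
def coinvEquiv (ha : IsLeftAction lact) (hl : IsLeftCoaction lam)
    (hall : ∀ t, lam (lact t) = diagAct lact (LinearMap.lTensor P lam t)) :
    P ⊗[k] coinvariants lam ≃ₗ[k] Y :=
  LinearEquiv.ofLinearMap (lact ∘ₗ LinearMap.lTensor P (coinvariants lam).subtype)
    (LinearMap.lTensor P (toCoinvariants (average_mem_coinvariants ha hl hall)) ∘ₗ lam)
    (by
      ext y
      rw [LinearMap.comp_apply, LinearMap.comp_apply, LinearMap.comp_apply,
        ← LinearMap.lTensor_comp_apply, subtype_comp_toCoinvariants, lact_average ha hl,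
        LinearMap.id_apply])
    (by
      refine TensorProduct.ext' fun p x => ?_
      have hx := mem_coinvariants.mp x.2
      have h₁ : toCoinvariants (average_mem_coinvariants ha hl hall) ∘ₗ lact ∘ₗ
          (TensorProduct.mk k P Y).flip x =
          LinearMap.smulRight (Coalgebra.counit (R := k)) x :=
        LinearMap.ext fun p => Subtype.ext (average_lact_coinvariant ha hx hall p)
      have h₂ (d : P ⊗[k] P) : LinearMap.lTensor P
          (LinearMap.smulRight (Coalgebra.counit (R := k)) x) d =
          TensorProduct.rid k P (LinearMap.lTensor P Coalgebra.counit d) ⊗ₜ x := by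
        induction d using TensorProduct.induction_on with
        | zero => simp
        | add x y hx hy => simp only [map_add, add_tmul, hx, hy]
        | tmul e f => simp [smul_tmul]
      rw [LinearMap.comp_apply, LinearMap.comp_apply, LinearMap.comp_apply,
        LinearMap.lTensor_tmul, Submodule.subtype_apply, lam_lact_coinvariant hx hall,
        ← LinearMap.lTensor_comp_apply, h₁, h₂]
      simp)

lemma coinvEquiv_tmul (ha : IsLeftAction lact) (hl : IsLeftCoaction lam)
    (hall : ∀ t, lam (lact t) = diagAct lact (LinearMap.lTensor P lam t)) (p : P)
    (x : coinvariants lam) :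
    coinvEquiv ha hl hall (p ⊗ₜ x) = lact (p ⊗ₜ (x : Y)) := rfl

lemma coinvEquiv_freeLact (ha : IsLeftAction lact) (hl : IsLeftCoaction lam)
    (hall : ∀ t, lam (lact t) = diagAct lact (LinearMap.lTensor P lam t)) (p : P)
    (z : P ⊗[k] coinvariants lam) :
    coinvEquiv ha hl hall (freeLact k P _ (p ⊗ₜ z)) = lact (p ⊗ₜ coinvEquiv ha hl hall z) := by
  induction z using TensorProduct.induction_on with
  | zero => simp
  | add x y hx hy => simp only [map_add, tmul_add, hx, hy]
  | tmul q x => rw [freeLact_tmul, coinvEquiv_tmul, coinvEquiv_tmul, ha.2]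

lemma coinvEquiv_freeRact (ha : IsLeftAction lact) (hl : IsLeftCoaction lam)
    (hall : ∀ t, lam (lact t) = diagAct lact (LinearMap.lTensor P lam t))
    {c : B →ₗ[k] P ⊗[k] B} {ract : Y ⊗[k] B →ₗ[k] Y}
    (hlr : ∀ (p : P) (y : Y) (b : B), ract (lact (p ⊗ₜ y) ⊗ₜ b) = lact (p ⊗ₜ ract (y ⊗ₜ b)))
    (hrl : lam ∘ₗ ract = (TensorProduct.map (LinearMap.mul' k P) ract) ∘ₗ
      (tensorTensorTensorComm k P Y P B).toLinearMap ∘ₗ (TensorProduct.map lam c))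
    (z : P ⊗[k] coinvariants lam) (b : B) :
    coinvEquiv ha hl hall (freeRact c (coinvRact h ract) (z ⊗ₜ b)) =
      ract (coinvEquiv ha hl hall z ⊗ₜ b) := by
  induction z using TensorProduct.induction_on with
  | zero => simp
  | add x y hx hy => simp only [map_add, add_tmul, hx, hy]
  | tmul q x =>
    rw [coinvEquiv_tmul, hlr, ← lact_lTensor_coinvRact (h := h) ha hl hrl, freeRact_tmul]
    generalize c b = t
    induction t using TensorProduct.induction_on with
    | zero => simp
    | add x y hx hy => simp only [map_add, tmul_add, hx, hy]
    | tmul e f => simp [coinvEquiv_tmul, ha.2]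

lemma lam_coinvEquiv (ha : IsLeftAction lact) (hl : IsLeftCoaction lam)
    (hall : ∀ t, lam (lact t) = diagAct lact (LinearMap.lTensor P lam t))
    (z : P ⊗[k] coinvariants lam) :
    lam (coinvEquiv ha hl hall z) =
      LinearMap.lTensor P (coinvEquiv ha hl hall).toLinearMap (freeLam k P _ z) := by
  induction z using TensorProduct.induction_on with
  | zero => simp
  | add x y hx hy => simp only [map_add, hx, hy]
  | tmul q x =>
    rw [coinvEquiv_tmul, lam_lact_coinvariant (mem_coinvariants.mp x.2) hall, freeLam_tmul]
    generalize (Coalgebra.comul (R := k) q) = d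
    induction d using TensorProduct.induction_on with
    | zero => simp
    | add x y hx hy => simp only [map_add, add_tmul, hx, hy]
    | tmul e f => simp [coinvEquiv_tmul]

lemma rho_coinvEquiv (ha : IsLeftAction lact) (hl : IsLeftCoaction lam)
    (hall : ∀ t, lam (lact t) = diagAct lact (LinearMap.lTensor P lam t))
    {π : P →ₐc[k] H} {ρ : Y →ₗ[k] Y ⊗[k] H}
    (hlρ : ∀ y, (LinearMap.rTensor H lam) (ρ y) =
      (TensorProduct.assoc k P Y H).symm ((LinearMap.lTensor P ρ) (lam y)))
    (hρl : ρ ∘ₗ lact = (TensorProduct.map lact (LinearMap.mul' k H)) ∘ₗ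
      (tensorTensorTensorComm k P H Y H).toLinearMap ∘ₗ (TensorProduct.map (piCoact π) ρ))
    (z : P ⊗[k] coinvariants lam) :
    ρ (coinvEquiv ha hl hall z) = LinearMap.rTensor H (coinvEquiv ha hl hall).toLinearMap
      (freeRho π (coinvRho h ρ) z) := by
  induction z using TensorProduct.induction_on with
  | zero => simp
  | add x y hx hy => simp only [map_add, hx, hy]
  | tmul q x =>
    rw [coinvEquiv_tmul, ← LinearMap.comp_apply ρ, hρl, LinearMap.comp_apply,
      LinearMap.comp_apply, map_tmul, ← rTensor_subtype_coinvRho (h := h) ha hlρ, freeRho_tmul]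
    generalize piCoact π q = t
    generalize coinvRho h ρ x = u
    induction t using TensorProduct.induction_on with
    | zero => simp
    | add x y hx hy => simp only [map_add, add_tmul, hx, hy]
    | tmul e f =>
      induction u using TensorProduct.induction_on with
      | zero => simp
      | add x y hx hy => simp only [map_add, tmul_add, hx, hy]
      | tmul y g => simp [coinvEquiv_tmul]

end CoinvariantModule

section Equivalence
variable {k P H : Type} [Field k] [Ring P] [HopfAlgebra k P] [Ring H] [HopfAlgebra k H]
variable {π : P →ₐc[k] H} {c : (qhsAlg π) →ₗ[k] P ⊗[k] (qhsAlg π)}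

lemma PPHBStr.average_mem {Y : Type} [AddCommGroup Y] [Module k Y] (s : PPHBStr π c Y) (y : Y) :
    average s.lact s.lam y ∈ coinvariants s.lam :=
  average_mem_coinvariants s.lact_action s.lam_coaction (lam_lact_apply s.lact_lam) y

/-- The crossed module `ᴾY` of coinvariants of a Hopf module `Y`. -/
def coinvObj (hc : IsRestrictedComul π c) (Y : PPHBMod π c) : CrossedMod π c where
  V := coinvariants Y.str.lam
  ract := coinvRact Y.str.average_mem Y.str.ract
  ρ := coinvRho Y.str.average_mem Y.str.ρ
  ract_action := coinvRact_isRightAction Y.str.lact_action Y.str.lam_coaction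
    (lam_lact_apply Y.str.lact_lam) hc.isLeftCoaction Y.str.ract_action Y.str.acts_comm
    Y.str.ract_lam
  ρ_coaction := coinvRho_isRightCoaction Y.str.lact_action Y.str.coacts_comm Y.str.ρ_coaction
  crossed := isCrossedPair_iff.mpr <| actLeg_coinvRact Y.str.lact_action Y.str.lam_coaction
    (lam_lact_apply Y.str.lact_lam) Y.str.coacts_comm Y.str.ract_lam Y.str.lact_ρ Y.str.ract_ρ

/-- A bijective morphism of Hopf modules is an isomorphism. -/
def PPHBMod.isoOfLinearEquiv {X Y : PPHBMod π c} (e : X.V ≃ₗ[k] Y.V)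
    (he : PPHBMod.Pres X Y e.toLinearMap) : X ≅ Y where
  hom := ⟨e.toLinearMap, he⟩
  inv := ⟨e.symm.toLinearMap, by
    obtain ⟨h₁, h₂, h₃, h₄⟩ := he
    simp only [LinearEquiv.coe_coe] at h₁ h₂ h₃ h₄
    have hs : e.symm.toLinearMap ∘ₗ e.toLinearMap = LinearMap.id := by ext; simp
    refine ⟨fun p v => ?_, fun v b => ?_, fun v => ?_, fun v => ?_⟩
    · simp [LinearEquiv.symm_apply_eq, h₁]
    · simp [LinearEquiv.symm_apply_eq, h₂]
    · obtain ⟨x, rfl⟩ := e.surjective v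
      rw [h₃, ← LinearMap.lTensor_comp_apply, hs]
      simp
    · obtain ⟨x, rfl⟩ := e.surjective v
      rw [h₄, ← LinearMap.rTensor_comp_apply, hs]
      simp⟩
  hom_inv_id := Subtype.ext <| LinearMap.ext e.symm_apply_apply
  inv_hom_id := Subtype.ext <| LinearMap.ext e.apply_symm_apply

lemma freeFunctor_essSurj (hc : IsRestrictedComul π c) : (freeFunctor hc).EssSurj where
  mem_essImage Y := ⟨coinvObj hc Y, ⟨PPHBMod.isoOfLinearEquiv
    (X := freeObj hc (coinvObj hc Y))
    (coinvEquiv Y.str.lact_action Y.str.lam_coaction (lam_lact_apply Y.str.lact_lam))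
    ⟨coinvEquiv_freeLact _ _ _,
      coinvEquiv_freeRact _ _ _ Y.str.acts_comm Y.str.ract_lam,
      lam_coinvEquiv _ _ _,
      rho_coinvEquiv _ _ _ Y.str.coacts_comm Y.str.lact_ρ⟩⟩⟩

end Equivalence

/-- For a Hopf algebra surjection `π : P → H` with `B = Pᴴ`, the
category of crossed `(H,B)`-modules is equivalent to the category of left
`P`-module, left `P`-comodule, right `H`-comodule, right `B`-module Hopf modules
(the equivalence being `X ↦ P ⊗ X` and `Y ↦ ᴾY` with twisted `B`-action). -/
theorem crossedMod_equiv_pphbMod (hπ : Function.Surjective π)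
    (hco : IsRestrictedComul π coactB) :
    Nonempty ((CrossedMod π coactB) ≌ (PPHBMod π coactB)) := by
  have := freeFunctor_faithful hco
  have := freeFunctor_full hco
  have := freeFunctor_essSurj hco
  have : (freeFunctor hco).IsEquivalence := { }
  exact ⟨(freeFunctor hco).asEquivalence⟩
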